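/- arXiv:2312.13014 — 3 statements merged into one kernel-verified Lean document; each statement's English description precedes it below -/
import Mathlib

section
/- Let A be a prime k-algebra that is a finitely generated module over its center Z. Then every ozone automorphism of A is conjugation by a regular normal element: for each k-algebra automorphism φ of A fixing Z pointwise, there exists a regular (non-zero-divisor) normal element a ∈ A such that a·φ(x) = x·a for all x ∈ A. -/
noncomputable section

/-- The **ozone group** of a `k`-algebra `A`: the group of `k`-algebra automorphisms
of `A` that fix the center of `A` pointwise. -/
def ozoneGroup (k A : Type*) [CommSemiring k] [Semiring A] [Algebra k A] :
    Subgroup (A ≃ₐ[k] A) where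
  carrier := {σ | ∀ z ∈ Subalgebra.center k A, σ z = z}
  one_mem' := fun _ _ => rfl
  mul_mem' := by
    intro σ τ hσ hτ z hz
    show σ (τ z) = z
    rw [hτ z hz, hσ z hz]
  inv_mem' := by
    intro σ hσ z hz
    show σ.symm z = z
    conv_lhs => rw [← hσ z hz]
    exact σ.symm_apply_apply z

/-- An element `a` of a ring is **normal** if `a·A = A·a`. -/
def IsNormal {A : Type*} [Mul A] (a : A) : Prop :=
  Set.range (fun x => a * x) = Set.range (fun x => x * a)

/-- A ring `B` is a **prime ring** if for all `a b`, `a·B·b = 0` implies `a = 0` or `b = 0`. -/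
def IsPrimeRing' (B : Type*) [Ring B] : Prop :=
  ∀ a b : B, (∀ x : B, a * x * b = 0) → a = 0 ∨ b = 0

/-- An element of a ring is **regular** if it is neither a left nor a right zero divisor. -/
def IsRegularElem {A : Type*} [Ring A] (a : A) : Prop :=
  (∀ z : A, z * a = 0 → z = 0) ∧ (∀ z : A, a * z = 0 → z = 0)

open TensorProduct

theorem prime_artinian_semisimple {Q : Type*} [Ring Q] [IsArtinianRing Q]
    (hp : IsPrimeRing' Q) : IsSemisimpleRing Q := by
  rw [IsArtinianRing.isSemisimpleRing_iff_jacobson]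
  obtain ⟨n, hn⟩ := IsSemiprimaryRing.isNilpotent (R := Q)
  generalize Ring.jacobson Q = J at hn
  induction n with
  | zero =>
    rw [Submodule.pow_zero, Submodule.zero_eq_bot, Ideal.one_eq_top] at hn
    exact le_bot_iff.mp (hn ▸ le_top)
  | succ n ih =>
    by_contra hJ
    obtain ⟨y, hy, hy0⟩ := Submodule.exists_mem_ne_zero_of_ne_bot hJ
    refine hJ (ih ?_)
    rw [Submodule.zero_eq_bot, eq_bot_iff]
    intro x hx
    have := hp x y (fun q => by
      have h1 : x * (q * y) ∈ J ^ n * J := Ideal.mul_mem_mul hx (J.mul_mem_left q hy)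
      rw [← Submodule.pow_succ, hn] at h1
      simpa [mul_assoc] using h1)
    simpa using this.resolve_right hy0

theorem prime_twosided {Q : Type*} [Ring Q] [IsArtinianRing Q] (hp : IsPrimeRing' Q)
    (I : Ideal Q) (hI : ∀ x ∈ I, ∀ q, x * q ∈ I) : I = ⊥ ∨ I = ⊤ := by
  have := prime_artinian_semisimple hp
  obtain ⟨J, hJ⟩ := exists_isCompl I
  by_cases h : I = ⊥
  · exact Or.inl h
  right
  obtain ⟨y, hy, hy0⟩ := Submodule.exists_mem_ne_zero_of_ne_bot h
  have : J = ⊥ := by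
    rw [eq_bot_iff]
    intro x hx
    have := hp y x (fun q => by
      have h1 : y * q * x ∈ I ⊓ J :=
        ⟨by rw [mul_assoc]; exact hI y hy _, J.mul_mem_left _ hx⟩
      rw [hJ.inf_eq_bot] at h1
      simpa using h1)
    simpa using this.resolve_left hy0
  have h2 := hJ.sup_eq_top
  rwa [this, sup_bot_eq] at h2

theorem mulLeftRight_bij {K Q : Type*} [Field K] [Ring Q] [Algebra K Q] [FiniteDimensional K Q]
    [Nontrivial Q] (hp : IsPrimeRing' Q)
    (hc : ∀ x : Q, (∀ y, x * y = y * x) → ∃ c : K, x = algebraMap K Q c) :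
    Function.Bijective (AlgHom.mulLeftRight K Q) := by
  have hart : IsArtinianRing Q := IsArtinianRing.of_finite K Q
  let _ : Module (Q ⊗[K] Qᵐᵒᵖ) Q := Module.compHom Q (AlgHom.mulLeftRight K Q).toRingHom
  have hsm : ∀ (e : Q ⊗[K] Qᵐᵒᵖ) (x : Q), e • x = AlgHom.mulLeftRight K Q e x := fun _ _ => rfl
  have hsm' : ∀ (a b x : Q), (a ⊗ₜ[K] MulOpposite.op b) • x = a * x * b := fun a b x => by
    rw [hsm, AlgHom.mulLeftRight_apply, MulOpposite.unop_op]
  have hsimple : IsSimpleModule (Q ⊗[K] Qᵐᵒᵖ) Q := by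
    refine { toNontrivial := inferInstance, eq_bot_or_eq_top := fun N => ?_ }
    let I : Ideal Q :=
      { carrier := N
        add_mem' := fun ha hb => N.add_mem ha hb
        zero_mem' := N.zero_mem
        smul_mem' := fun c x hx => by
          have := N.smul_mem (c ⊗ₜ[K] MulOpposite.op 1) hx
          rwa [hsm', mul_one] at this }
    have h1 : ∀ x, x ∈ I ↔ x ∈ N := fun x => Iff.rfl
    rcases prime_twosided hp I (fun x hx q => by
      have := N.smul_mem (1 ⊗ₜ[K] MulOpposite.op q) hx
      rwa [hsm', one_mul] at this) with h | h
    · left; ext x; rw [← h1, h]; simp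
    · right; ext x; rw [← h1, h]; simp
  have hsurj : Function.Surjective (AlgHom.mulLeftRight K Q) := by
    intro f
    have hg : ∀ g : Module.End (Q ⊗[K] Qᵐᵒᵖ) Q, ∃ c : K, ∀ x, g x = c • x := by
      intro g
      have hl : ∀ x, g x = x * g 1 := fun x => by
        have := g.map_smul (x ⊗ₜ[K] MulOpposite.op 1) 1
        rwa [hsm', hsm', mul_one, mul_one, mul_one] at this
      have hr : ∀ x, g x = g 1 * x := fun x => by
        have := g.map_smul (1 ⊗ₜ[K] MulOpposite.op x) 1
        rwa [hsm', hsm', mul_one, one_mul, one_mul] at this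
      obtain ⟨c, h⟩ := hc (g 1) (fun y => by rw [← hl, ← hr])
      exact ⟨c, fun x => by rw [hr, h, Algebra.smul_def]⟩
    let f' : Module.End (Module.End (Q ⊗[K] Qᵐᵒᵖ) Q) Q :=
      { toFun := f
        map_add' := f.map_add
        map_smul' := fun g x => by
          obtain ⟨c, h⟩ := hg g
          simp [Module.End.smul_def, h] }
    obtain ⟨s, hs⟩ := Module.Finite.fg_top (R := K) (M := Q)
    obtain ⟨e, he⟩ := jacobson_density f' s
    refine ⟨e, ?_⟩
    refine LinearMap.ext_on (s := (s : Set Q)) hs (fun x hx => ?_)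
    exact (he x hx).symm
  refine ⟨?_, hsurj⟩
  have hfr : Module.finrank K (Q ⊗[K] Qᵐᵒᵖ) = Module.finrank K (Module.End K Q) := by
    rw [Module.finrank_tensorProduct, Module.finrank_linearMap,
      ← (MulOpposite.opLinearEquiv K : Q ≃ₗ[K] Qᵐᵒᵖ).finrank_eq]
  exact (LinearMap.injective_iff_surjective_of_finrank_eq_finrank
    (f := (AlgHom.mulLeftRight K Q).toLinearMap) hfr).mpr hsurj

theorem skolem_noether_aux {K Q : Type*} [Field K] [Ring Q] [Algebra K Q] [FiniteDimensional K Q]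
    [Nontrivial Q] (hp : IsPrimeRing' Q)
    (hc : ∀ x : Q, (∀ y, x * y = y * x) → ∃ c : K, x = algebraMap K Q c) (φ : Q →ₐ[K] Q) :
    ∃ b : Q, b ≠ 0 ∧ ∀ y, y * b = b * φ y := by
  obtain ⟨hinj, hsurj⟩ := mulLeftRight_bij hp hc
  obtain ⟨t, ht⟩ := hsurj φ.toLinearMap
  let B := Module.finBasis K Q
  obtain ⟨c, rfl⟩ := TensorProduct.eq_repr_basis_left B t
  have hsum : ∀ x, φ x = c.sum fun i n => B i * x * n.unop := fun x => by
    have := congrArg (fun f => f x) ht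
    simp only [Finsupp.sum, map_sum, LinearMap.sum_apply, AlgHom.mulLeftRight_apply] at this
    exact this.symm
  have key : ∀ i y, y * (c i).unop = (c i).unop * φ y := by
    intro i y
    let d : Fin (Module.finrank K Q) →₀ Qᵐᵒᵖ :=
      Finsupp.mapRange (fun n : Qᵐᵒᵖ => MulOpposite.op (y * n.unop - n.unop * φ y)) (by simp) c
    have hd : (d.sum fun i n => B i ⊗ₜ[K] n) = 0 := by
      apply hinj
      rw [map_zero]
      ext x
      rw [Finsupp.sum_mapRange_index (by simp)]
      simp only [Finsupp.sum, map_sum, LinearMap.sum_apply, AlgHom.mulLeftRight_apply,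
        MulOpposite.unop_op, LinearMap.zero_apply]
      have h1 := map_mul φ x y
      rw [hsum (x * y), hsum x] at h1
      simp only [Finsupp.sum, Finset.sum_mul] at h1
      rw [← sub_eq_zero, ← Finset.sum_sub_distrib] at h1
      rw [← h1]
      refine Finset.sum_congr rfl fun i _ => ?_
      rw [mul_sub]
      simp only [mul_assoc]
    have h0 := TensorProduct.sum_tmul_basis_left_eq_zero B d hd
    have : d i = 0 := by rw [h0]; rfl
    simp only [d, Finsupp.mapRange_apply, MulOpposite.op_eq_zero_iff] at this
    exact sub_eq_zero.mp this
  by_contra! hcon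
  have hz : ∀ i, c i = 0 := fun i => by
    by_contra h
    obtain ⟨y, hy⟩ := hcon (c i).unop (by simpa using h)
    exact hy (key i y)
  have h1 := hsum 1
  rw [show c = 0 from Finsupp.ext hz] at h1
  simp at h1

theorem exists_twist {Z A : Type*} [CommRing Z] [Ring A] [Algebra Z A] [Nontrivial A]
    (hprime : IsPrimeRing' A) (hZinj : Function.Injective (algebraMap Z A))
    (hcen : ∀ x : A, (∀ y, x * y = y * x) → ∃ z : Z, x = algebraMap Z A z)
    [Module.Finite Z A] (φ : A →ₐ[Z] A) :
    ∃ a : A, a ≠ 0 ∧ ∀ x, x * a = a * φ x := by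
  have hreg : ∀ (z : Z) (x : A), z • x = 0 → z = 0 ∨ x = 0 := fun z x h => by
    rcases hprime (algebraMap Z A z) x (fun q => by
      rw [← Algebra.smul_def, smul_mul_assoc, ← mul_smul_comm, h, mul_zero]) with h | h
    · exact Or.inl (hZinj (by rw [h, map_zero]))
    · exact Or.inr h
  have hntZ : Nontrivial Z := (algebraMap Z A).domain_nontrivial
  have hdom : IsDomain Z := by
    have : NoZeroDivisors Z := ⟨fun {a b} h => by
      rcases hreg a (algebraMap Z A b) (by rw [Algebra.smul_def, ← map_mul, h, map_zero]) with h | h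
      · exact Or.inl h
      · exact Or.inr (hZinj (by rw [h, map_zero]))⟩
    exact NoZeroDivisors.to_isDomain Z
  let K := FractionRing Z
  let ι : A →ₐ[Z] K ⊗[Z] A := Algebra.TensorProduct.includeRight
  have hιloc : IsLocalizedModule (nonZeroDivisors Z) (TensorProduct.mk Z K A 1) := inferInstance
  have hιi : Function.Injective ι := by
    intro x y h
    obtain ⟨c, hc⟩ := (IsLocalizedModule.eq_iff_exists (nonZeroDivisors Z)
      (TensorProduct.mk Z K A 1)).mp (show TensorProduct.mk Z K A 1 x = _ from h)
    have h1 : (c : Z) • (x - y) = 0 := by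
      rw [smul_sub, sub_eq_zero]; exact hc
    exact sub_eq_zero.mp ((hreg _ _ h1).resolve_left (nonZeroDivisors.coe_ne_zero c))
  have hsurj : ∀ q : K ⊗[Z] A, ∃ (c : K) (a : A), c ≠ 0 ∧ ι a = c • q := by
    intro q
    obtain ⟨⟨a, s⟩, h⟩ := IsLocalizedModule.surj (nonZeroDivisors Z)
      (TensorProduct.mk Z K A 1) q
    refine ⟨algebraMap Z K s, a, ?_, ?_⟩
    · simpa using nonZeroDivisors.coe_ne_zero s
    · rw [algebraMap_smul]; exact h.symm
  have hnt : Nontrivial (K ⊗[Z] A) := hιi.nontrivial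
  have hpQ : IsPrimeRing' (K ⊗[Z] A) := by
    intro p q h
    obtain ⟨c, a, hc, ha⟩ := hsurj p
    obtain ⟨d, b, hd, hb⟩ := hsurj q
    rcases hprime a b (fun x => hιi (by
      rw [map_mul, map_mul, ha, hb, smul_mul_assoc, smul_mul_smul_comm, h, smul_zero,
        map_zero])) with h | h
    · left
      rw [h, map_zero] at ha
      exact (smul_eq_zero.mp ha.symm).resolve_left hc
    · right
      rw [h, map_zero] at hb
      exact (smul_eq_zero.mp hb.symm).resolve_left hd
  have hcQ : ∀ x : K ⊗[Z] A, (∀ y, x * y = y * x) → ∃ c : K, x = algebraMap K (K ⊗[Z] A) c := by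
    intro x hx
    obtain ⟨c, a, hc, ha⟩ := hsurj x
    obtain ⟨z, hz⟩ := hcen a (fun y => hιi (by
      rw [map_mul, map_mul, ha, smul_mul_assoc, mul_smul_comm, hx]))
    refine ⟨c⁻¹ * algebraMap Z K z, ?_⟩
    rw [hz, AlgHom.commutes, IsScalarTower.algebraMap_apply Z K (K ⊗[Z] A)] at ha
    rw [map_mul, ha, ← Algebra.smul_def, smul_smul, inv_mul_cancel₀ hc, one_smul]
  obtain ⟨b, hb0, hb⟩ := skolem_noether_aux hpQ hcQ
    (Algebra.TensorProduct.map (AlgHom.id K K) φ)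
  obtain ⟨c, a, hc, ha⟩ := hsurj b
  refine ⟨a, ?_, fun x => hιi ?_⟩
  · rintro rfl
    rw [map_zero] at ha
    exact hb0 ((smul_eq_zero.mp ha.symm).resolve_left hc)
  · have h1 := hb (ι x)
    have h2 : Algebra.TensorProduct.map (AlgHom.id K K) φ (ι x) = ι (φ x) := by
      simp [ι]
    rw [h2] at h1
    rw [map_mul, map_mul, ha, smul_mul_assoc, mul_smul_comm, h1]

/-- Let `A` be a prime `k`-algebra that is a finitely generated module over
its center `Z`. Then every ozone automorphism of `A` is conjugation by a regular normal
element: for each `k`-algebra automorphism `φ` of `A` fixing `Z` pointwise, there is a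
regular (non-zero-divisor) normal element `a ∈ A` with `a·φ(x) = x·a` for all `x ∈ A`. -/
theorem stmt0 (k A : Type*) [Field k] [CharZero k] [Ring A] [Algebra k A]
    (hprime : IsPrimeRing' A)
    [Module.Finite (Subalgebra.center k A) A]
    (φ : A ≃ₐ[k] A) (hφ : φ ∈ ozoneGroup k A) :
    ∃ a : A, IsRegularElem a ∧ IsNormal a ∧ ∀ x : A, a * φ x = x * a := by
  rcases subsingleton_or_nontrivial A with hA | hA
  · exact ⟨0, ⟨fun z _ => Subsingleton.elim _ _, fun z _ => Subsingleton.elim _ _⟩,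
      Set.ext fun w => ⟨fun _ => ⟨0, Subsingleton.elim _ _⟩, fun _ => ⟨0, Subsingleton.elim _ _⟩⟩,
      fun _ => Subsingleton.elim _ _⟩
  let _ : Algebra (Subalgebra.center k A) A :=
    { smul := fun z a => z • a
      algebraMap := (Subalgebra.center k A).val.toRingHom
      commutes' := fun z a => ((Subalgebra.mem_center_iff.mp z.2) a).symm
      smul_def' := fun z a => rfl }
  have hfin : Module.Finite (Subalgebra.center k A) A := ‹_›
  let φ' : A →ₐ[Subalgebra.center k A] A :=
    { φ.toAlgHom.toRingHom with
      commutes' := fun z => hφ z.1 z.2 }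
  obtain ⟨a, ha0, ha⟩ := exists_twist (Z := Subalgebra.center k A) hprime
    Subtype.val_injective
    (fun x hx => ⟨⟨x, Subalgebra.mem_center_iff.mpr fun y => (hx y).symm⟩, rfl⟩) φ'
  have ha' : ∀ x, a * φ x = x * a := fun x => (ha x).symm
  refine ⟨a, ⟨fun z hz => ?_, fun z hz => ?_⟩, ?_, ha'⟩
  · exact (hprime z a fun x => by rw [mul_assoc, ← ha', ← mul_assoc, hz, zero_mul]).resolve_right ha0
  · refine (hprime a z fun x => ?_).resolve_left ha0
    obtain ⟨y, rfl⟩ := φ.surjective x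
    rw [ha', mul_assoc, hz, mul_zero]
  · ext w
    constructor
    · rintro ⟨x, rfl⟩
      obtain ⟨y, rfl⟩ := φ.surjective x
      exact ⟨y, (ha' y).symm⟩
    · rintro ⟨x, rfl⟩
      exact ⟨φ x, ha' x⟩
end
end

section
/- Let q ∈ k be a primitive ℓth root of unity with ℓ ≥ 2 and ℓ ≠ 3, and let H_q be the quantum Heisenberg algebra. Set Ω = xy − q^{-2}yx. Then the center Z(H_q) is generated as a k-algebra by x^ℓ, y^ℓ, z^ℓ, and Ωz. -/
noncomputable section

/-- The defining relations of the quantum Heisenberg algebra `H_q`: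
`zx = q·xz`, `yz = q·zy`, and `xy = q·yx + z²` (generators `x = ι 0`, `y = ι 1`, `z = ι 2`). -/
inductive HeisRel (k : Type*) [Field k] (q : k) :
    FreeAlgebra k (Fin 3) → FreeAlgebra k (Fin 3) → Prop
  | zx : HeisRel k q (FreeAlgebra.ι k 2 * FreeAlgebra.ι k 0)
      (q • (FreeAlgebra.ι k 0 * FreeAlgebra.ι k 2))
  | yz : HeisRel k q (FreeAlgebra.ι k 1 * FreeAlgebra.ι k 2)
      (q • (FreeAlgebra.ι k 2 * FreeAlgebra.ι k 1))
  | xy : HeisRel k q (FreeAlgebra.ι k 0 * FreeAlgebra.ι k 1)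
      (q • (FreeAlgebra.ι k 1 * FreeAlgebra.ι k 0) + FreeAlgebra.ι k 2 ^ 2)

/-- The quantum Heisenberg algebra `H_q = k⟨x,y,z⟩/(zx − qxz, yz − qzy, xy − qyx − z²)`. -/
abbrev Heis (k : Type*) [Field k] (q : k) := RingQuot (HeisRel k q)

/-- The generator `x` of `H_q`. -/
def Heis.x (k : Type*) [Field k] (q : k) : Heis k q :=
  RingQuot.mkAlgHom k (HeisRel k q) (FreeAlgebra.ι k 0)

/-- The generator `y` of `H_q`. -/
def Heis.y (k : Type*) [Field k] (q : k) : Heis k q :=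
  RingQuot.mkAlgHom k (HeisRel k q) (FreeAlgebra.ι k 1)

/-- The generator `z` of `H_q`. -/
def Heis.z (k : Type*) [Field k] (q : k) : Heis k q :=
  RingQuot.mkAlgHom k (HeisRel k q) (FreeAlgebra.ι k 2)

namespace HeisAux

variable {k : Type*} [Field k] (q : k)

def dseq : ℕ → k
  | 0 => 0
  | n + 1 => q ^ n + q⁻¹ ^ 2 * dseq n

lemma dseq_formula (n : ℕ) : (q - q⁻¹ ^ 2) * dseq q n = q ^ n - q⁻¹ ^ (2 * n) := by
  induction n with
  | zero => simp [dseq]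
  | succ n ih =>
    have : (q - q⁻¹ ^ 2) * dseq q (n+1) = (q - q⁻¹ ^ 2) * q ^ n + q⁻¹ ^ 2 * ((q - q⁻¹ ^ 2) * dseq q n) := by
      simp only [dseq]; ring
    rw [this, ih]; ring

lemma dseq_succ' (n : ℕ) : dseq q (n + 1) = q * dseq q n + q⁻¹ ^ (2 * n) := by
  induction n with
  | zero => simp [dseq]
  | succ n ih =>
    have h1 : dseq q (n + 1) = q ^ n + q⁻¹ ^ 2 * dseq q n := rfl
    have h2 : dseq q (n + 1 + 1) = q ^ (n + 1) + q⁻¹ ^ 2 * dseq q (n + 1) := rfl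
    linear_combination h2 - q * h1 + q⁻¹ ^ 2 * ih

section relations
variable {A : Type*} [Ring A] [Algebra k A] {x y z : A}

lemma zpow_y (hzy : z * y = q⁻¹ • (y * z)) (n : ℕ) : z * y ^ n = q⁻¹ ^ n • (y ^ n * z) := by
  induction n with
  | zero => simp
  | succ n ih =>
    rw [pow_succ, ← mul_assoc, ih, smul_mul_assoc, mul_assoc, hzy, mul_smul_comm, smul_smul, mul_assoc, pow_succ]

lemma powz_y (hzy : z * y = q⁻¹ • (y * z)) (n : ℕ) : z ^ n * y = q⁻¹ ^ n • (y * z ^ n) := by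
  induction n with
  | zero => simp
  | succ n ih =>
    rw [pow_succ', mul_assoc, ih, mul_smul_comm, ← mul_assoc, hzy, smul_mul_assoc, smul_smul, mul_assoc, pow_succ]

lemma x_y (hzy : z * y = q⁻¹ • (y * z)) (hxy : x * y = q • (y * x) + z ^ 2) (n : ℕ) :
    x * y ^ (n + 1) = q ^ (n + 1) • (y ^ (n + 1) * x) + dseq q (n + 1) • (y ^ n * z ^ 2) := by
  induction n with
  | zero => simp [dseq, hxy]
  | succ n ih =>
    rw [pow_succ y (n + 1), ← mul_assoc, ih, add_mul, smul_mul_assoc, smul_mul_assoc, mul_assoc, hxy,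
      mul_assoc, powz_y q hzy,
      show dseq q (n + 1 + 1) = q ^ (n + 1) + q⁻¹ ^ 2 * dseq q (n + 1) from rfl]
    simp only [mul_add, mul_smul_comm, smul_add, smul_smul, ← mul_assoc, ← pow_succ]
    module

lemma x_y' (hxz : x * z = q⁻¹ • (z * x)) (hxy : x * y = q • (y * x) + z ^ 2) (n : ℕ) :
    x ^ (n + 1) * y = q ^ (n + 1) • (y * x ^ (n + 1)) + dseq q (n + 1) • (z ^ 2 * x ^ n) := by
  induction n with
  | zero => simp [dseq, hxy]
  | succ n ih =>
    have h2 : x * z ^ 2 = q⁻¹ ^ 2 • (z ^ 2 * x) := zpow_y q hxz 2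
    rw [pow_succ' x (n + 1), mul_assoc, ih, mul_add, mul_smul_comm, mul_smul_comm, ← mul_assoc, hxy,
      ← mul_assoc, h2,
      show dseq q (n + 1 + 1) = q ^ (n + 1) + q⁻¹ ^ 2 * dseq q (n + 1) from rfl]
    simp only [add_mul, smul_mul_assoc, smul_add, smul_smul, mul_assoc, ← pow_succ']
    module

lemma omega_comm (hq : q ≠ 0) (hzy : z * y = q⁻¹ • (y * z)) (hxz : x * z = q⁻¹ • (z * x))
    (hxy : x * y = q • (y * x) + z ^ 2) :
    let w := (x * y - (q⁻¹ ^ 2) • (y * x)) * z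
    x * w = w * x ∧ y * w = w * y ∧ z * w = w * z := by
  have hzy' : ∀ t, z * (y * t) = q⁻¹ • (y * (z * t)) := fun t => by
    rw [← mul_assoc, hzy, smul_mul_assoc, mul_assoc]
  have hxz' : ∀ t, x * (z * t) = q⁻¹ • (z * (x * t)) := fun t => by
    rw [← mul_assoc, hxz, smul_mul_assoc, mul_assoc]
  have hxy' : ∀ t, x * (y * t) = q • (y * (x * t)) + z * (z * t) := fun t => by
    rw [← mul_assoc, hxy, add_mul, smul_mul_assoc, mul_assoc, pow_two, mul_assoc]
  rw [pow_two] at hxy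
  refine ⟨?_, ?_, ?_⟩ <;>
  · simp only [mul_add, add_mul, mul_sub, sub_mul, smul_mul_assoc, mul_smul_comm, mul_assoc, hzy, hxz, hxy,
      hzy', hxz', hxy', smul_add, smul_smul]
    try (match_scalars <;> field_simp <;> try ring)
end relations

abbrev M (k : Type*) [Field k] := (ℕ × ℕ × ℕ) →₀ k

/-- basis vector corresponding to `y^b z^c x^a` -/
abbrev e (k : Type*) [Field k] (b c a : ℕ) : M k := Finsupp.single (b, c, a) 1

def opY : M k →ₗ[k] M k := Finsupp.linearCombination k fun p => e k (p.1 + 1) p.2.1 p.2.2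
def opZ : M k →ₗ[k] M k := Finsupp.linearCombination k fun p => q⁻¹ ^ p.1 • e k p.1 (p.2.1 + 1) p.2.2
def opX : M k →ₗ[k] M k := Finsupp.linearCombination k fun p =>
  (q ^ p.1 * q⁻¹ ^ p.2.1) • e k p.1 p.2.1 (p.2.2 + 1) + dseq q p.1 • e k (p.1 - 1) (p.2.1 + 2) p.2.2
def opRX : M k →ₗ[k] M k := Finsupp.linearCombination k fun p => e k p.1 p.2.1 (p.2.2 + 1)
def opRZ : M k →ₗ[k] M k := Finsupp.linearCombination k fun p => q⁻¹ ^ p.2.2 • e k p.1 (p.2.1 + 1) p.2.2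

lemma opY_e (b c a : ℕ) : opY (e k b c a) = e k (b + 1) c a := by
  simp [opY]
lemma opZ_e (b c a : ℕ) : opZ q (e k b c a) = q⁻¹ ^ b • e k b (c + 1) a := by
  simp [opZ]
lemma opX_e (b c a : ℕ) : opX q (e k b c a) =
    (q ^ b * q⁻¹ ^ c) • e k b c (a + 1) + dseq q b • e k (b - 1) (c + 2) a := by
  rw [opX, Finsupp.linearCombination_single, one_smul]
lemma opRX_e (b c a : ℕ) : opRX (e k b c a) = e k b c (a + 1) := by
  simp [opRX]
lemma opRZ_e (b c a : ℕ) : opRZ q (e k b c a) = q⁻¹ ^ a • e k b (c + 1) a := by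
  simp [opRZ]

lemma ext_e {N : Type*} [AddCommGroup N] [Module k N] {f g : M k →ₗ[k] N}
    (h : ∀ b c a, f (e k b c a) = g (e k b c a)) : f = g := by
  apply Finsupp.lhom_ext'
  rintro ⟨b, c, a⟩
  ext
  exact h b c a

def rep (hq : q ≠ 0) : Heis k q →ₐ[k] Module.End k (M k) :=
  RingQuot.liftAlgHom k ⟨FreeAlgebra.lift k ![opX q, opY, opZ q], by
    intro r s h
    induction h with
    | zx =>
      simp only [map_mul, map_smul, FreeAlgebra.lift_ι_apply]
      apply ext_e
      intro b c a
      simp [-Finsupp.smul_single, Module.End.mul_apply, opX_e, opZ_e, smul_smul]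
      rcases b with _ | b
      · simp only [dseq]
        match_scalars <;> field_simp <;> try ring
      · simp only [Nat.add_sub_cancel]
        match_scalars <;> field_simp <;> try ring
    | yz =>
      simp only [map_mul, map_smul, FreeAlgebra.lift_ι_apply]
      apply ext_e
      intro b c a
      change opY (opZ q (e k b c a)) = q • opZ q (opY (e k b c a))
      rw [opZ_e, map_smul, opY_e, opY_e, opZ_e, smul_smul, pow_succ, mul_comm q, mul_assoc,
        inv_mul_cancel₀ hq, mul_one]
    | xy =>
      simp only [map_mul, map_smul, map_add, map_pow, FreeAlgebra.lift_ι_apply]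
      apply ext_e
      intro b c a
      simp [-Finsupp.smul_single, Module.End.mul_apply, pow_two, opX_e, opY_e, opZ_e, smul_smul]
      rcases b with _ | b
      · simp only [dseq]
        match_scalars <;> simp
      · rw [dseq_succ' q (b + 1)]
        simp only [Nat.add_sub_cancel]
        match_scalars <;> ring⟩

lemma rep_x (hq : q ≠ 0) : rep q hq (Heis.x k q) = opX q := by
  simp [rep, Heis.x]
lemma rep_y (hq : q ≠ 0) : rep q hq (Heis.y k q) = opY := by
  simp [rep, Heis.y]
lemma rep_z (hq : q ≠ 0) : rep q hq (Heis.z k q) = opZ q := by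
  simp [rep, Heis.z]

lemma rel_zy (hq : q ≠ 0) : Heis.z k q * Heis.y k q = q⁻¹ • (Heis.y k q * Heis.z k q) := by
  have h := RingQuot.mkAlgHom_rel k (HeisRel.yz (k := k) (q := q))
  simp only [map_mul, map_smul] at h
  change Heis.y k q * Heis.z k q = q • (Heis.z k q * Heis.y k q) at h
  rw [h, smul_smul, inv_mul_cancel₀ hq, one_smul]

lemma rel_xz (hq : q ≠ 0) : Heis.x k q * Heis.z k q = q⁻¹ • (Heis.z k q * Heis.x k q) := by
  have h := RingQuot.mkAlgHom_rel k (HeisRel.zx (k := k) (q := q))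
  simp only [map_mul, map_smul] at h
  change Heis.z k q * Heis.x k q = q • (Heis.x k q * Heis.z k q) at h
  rw [h, smul_smul, inv_mul_cancel₀ hq, one_smul]

lemma rel_xy : Heis.x k q * Heis.y k q = q • (Heis.y k q * Heis.x k q) + Heis.z k q ^ 2 := by
  have h := RingQuot.mkAlgHom_rel k (HeisRel.xy (k := k) (q := q))
  simp only [map_mul, map_smul, map_add, map_pow] at h
  exact h

lemma heis_induction {P : Heis k q → Prop} (hx : P (Heis.x k q)) (hy : P (Heis.y k q))
    (hz : P (Heis.z k q)) (hs : ∀ r : k, P (algebraMap k _ r)) (ha : ∀ a b, P a → P b → P (a + b))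
    (hm : ∀ a b, P a → P b → P (a * b)) (w : Heis k q) : P w := by
  obtain ⟨w, rfl⟩ := RingQuot.mkAlgHom_surjective k (HeisRel k q) w
  induction w using FreeAlgebra.induction with
  | grade0 r => rw [AlgHom.commutes]; exact hs r
  | grade1 i =>
    fin_cases i
    · exact hx
    · exact hy
    · exact hz
  | mul a b h1 h2 => rw [map_mul]; exact hm _ _ h1 h2
  | add a b h1 h2 => rw [map_add]; exact ha _ _ h1 h2

lemma central_of_comm {w : Heis k q} (hx : Heis.x k q * w = w * Heis.x k q)
    (hy : Heis.y k q * w = w * Heis.y k q) (hz : Heis.z k q * w = w * Heis.z k q) :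
    w ∈ Subalgebra.center k (Heis k q) := by
  rw [Subalgebra.mem_center_iff]
  intro t
  induction t using heis_induction with
  | hx => exact hx
  | hy => exact hy
  | hz => exact hz
  | hs r => exact Algebra.commutes r w
  | ha a b h1 h2 => rw [add_mul, mul_add, h1, h2]
  | hm a b h1 h2 => rw [mul_assoc, h2, ← mul_assoc, h1, mul_assoc]

/-- from coordinates to the algebra -/
def psi : M k →ₗ[k] Heis k q := Finsupp.linearCombination k fun p =>
  Heis.y k q ^ p.1 * Heis.z k q ^ p.2.1 * Heis.x k q ^ p.2.2

lemma psi_e (b c a : ℕ) : psi q (e k b c a) = Heis.y k q ^ b * Heis.z k q ^ c * Heis.x k q ^ a := by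
  simp [psi]

lemma psi_x (hq : q ≠ 0) (m : M k) : psi q (opX q m) = Heis.x k q * psi q m := by
  suffices psi q ∘ₗ opX q = LinearMap.mulLeft k (Heis.x k q) ∘ₗ psi q from LinearMap.congr_fun this m
  apply ext_e
  intro b c a
  simp only [LinearMap.comp_apply, opX_e, LinearMap.mulLeft_apply, map_add, map_smul, psi_e]
  have h2 := zpow_y q (rel_xz q hq) c
  rcases b with _ | b
  · simp only [dseq, pow_zero, one_mul, zero_smul, add_zero]
    rw [← mul_assoc, h2, smul_mul_assoc, mul_assoc, ← pow_succ']
  · rw [← mul_assoc, ← mul_assoc, x_y q (rel_zy q hq) (rel_xy q), add_mul, smul_mul_assoc, mul_assoc _ _ (Heis.z k q ^ c), h2]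
    simp only [Nat.add_sub_cancel, pow_add (Heis.z k q), pow_succ' (Heis.x k q), add_mul, smul_mul_assoc, mul_smul_comm, smul_smul, mul_assoc]
    rw [← mul_assoc (Heis.z k q ^ c) (Heis.z k q ^ 2), ← pow_add, ← mul_assoc (Heis.z k q ^ 2), ← pow_add, add_comm c 2]

lemma psi_y (m : M k) : psi q (opY m) = Heis.y k q * psi q m := by
  suffices psi q ∘ₗ opY = LinearMap.mulLeft k (Heis.y k q) ∘ₗ psi q from LinearMap.congr_fun this m
  apply ext_e
  intro b c a
  simp only [LinearMap.comp_apply, opY_e, LinearMap.mulLeft_apply, psi_e, pow_succ', mul_assoc]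

lemma psi_z (hq : q ≠ 0) (m : M k) : psi q (opZ q m) = Heis.z k q * psi q m := by
  suffices psi q ∘ₗ opZ q = LinearMap.mulLeft k (Heis.z k q) ∘ₗ psi q from LinearMap.congr_fun this m
  apply ext_e
  intro b c a
  simp only [LinearMap.comp_apply, opZ_e, LinearMap.mulLeft_apply, psi_e, map_smul]
  rw [← mul_assoc, ← mul_assoc, zpow_y q (rel_zy q hq), smul_mul_assoc, smul_mul_assoc, pow_succ']
  simp only [mul_assoc]

lemma psi_rep (hq : q ≠ 0) (w : Heis k q) : ∀ m : M k, psi q (rep q hq w m) = w * psi q m := by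
  induction w using heis_induction with
  | hx => intro m; rw [rep_x, psi_x q hq]
  | hy => intro m; rw [rep_y, psi_y]
  | hz => intro m; rw [rep_z, psi_z q hq]
  | hs r =>
    intro m
    rw [AlgHom.commutes, Module.algebraMap_end_apply, map_smul, Algebra.smul_def]
  | ha a b h1 h2 => intro m; rw [map_add, LinearMap.add_apply, map_add, h1, h2, add_mul]
  | hm a b h1 h2 => intro m; rw [map_mul, Module.End.mul_apply, h1, h2, mul_assoc]

/-- coordinates -/
def phi (hq : q ≠ 0) : Heis k q →ₗ[k] M k := (rep q hq).toLinearMap.flip (e k 0 0 0)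

lemma phi_apply (hq : q ≠ 0) (w : Heis k q) : phi q hq w = rep q hq w (e k 0 0 0) := rfl

lemma phi_mul (hq : q ≠ 0) (v w : Heis k q) : phi q hq (v * w) = rep q hq v (phi q hq w) := by
  simp only [phi_apply, map_mul, Module.End.mul_apply]

lemma psi_phi (hq : q ≠ 0) (w : Heis k q) : psi q (phi q hq w) = w := by
  rw [phi_apply, psi_rep, psi_e]; simp

lemma phi_mono (hq : q ≠ 0) (b c a : ℕ) :
    phi q hq (Heis.y k q ^ b * Heis.z k q ^ c * Heis.x k q ^ a) = e k b c a := by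
  have h1 : ∀ a, (opX q ^ a : Module.End k (M k)) (e k 0 0 0) = e k 0 0 a := by
    intro a
    induction a with
    | zero => simp
    | succ a ih => rw [pow_succ', Module.End.mul_apply, ih, opX_e]; simp [dseq]
  have h2 : ∀ c, (opZ q ^ c : Module.End k (M k)) (e k 0 0 a) = e k 0 c a := by
    intro c
    induction c with
    | zero => simp
    | succ c ih => rw [pow_succ', Module.End.mul_apply, ih, opZ_e]; simp
  have h3 : ∀ b, (opY ^ b : Module.End k (M k)) (e k 0 c a) = e k b c a := by
    intro b
    induction b with
    | zero => simp
    | succ b ih => rw [pow_succ', Module.End.mul_apply, ih, opY_e]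
  rw [phi_apply]
  simp only [map_mul, map_pow, rep_x, rep_y, rep_z, Module.End.mul_apply, h1, h2, h3]

lemma phi_psi (hq : q ≠ 0) (m : M k) : phi q hq (psi q m) = m := by
  suffices phi q hq ∘ₗ psi q = LinearMap.id from LinearMap.congr_fun this m
  apply ext_e
  intro b c a
  simp only [LinearMap.comp_apply, psi_e, phi_mono, LinearMap.id_apply]

lemma phi_mul_x (hq : q ≠ 0) (w : Heis k q) : phi q hq (w * Heis.x k q) = opRX (phi q hq w) := by
  have : psi q ∘ₗ opRX = LinearMap.mulRight k (Heis.x k q) ∘ₗ psi q := by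
    apply ext_e
    intro b c a
    simp only [LinearMap.comp_apply, opRX_e, LinearMap.mulRight_apply, psi_e, pow_succ, mul_assoc]
  have h := LinearMap.congr_fun this (phi q hq w)
  simp only [LinearMap.comp_apply, LinearMap.mulRight_apply, psi_phi] at h
  rw [← h, phi_psi]

lemma phi_mul_z (hq : q ≠ 0) (w : Heis k q) : phi q hq (w * Heis.z k q) = opRZ q (phi q hq w) := by
  have : psi q ∘ₗ opRZ q = LinearMap.mulRight k (Heis.z k q) ∘ₗ psi q := by
    apply ext_e
    intro b c a
    simp only [LinearMap.comp_apply, opRZ_e, LinearMap.mulRight_apply, psi_e, map_smul]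
    rw [mul_assoc _ _ (Heis.z k q), powz_y q (rel_xz q hq), mul_smul_comm, pow_succ]
    simp only [mul_assoc]
  have h := LinearMap.congr_fun this (phi q hq w)
  simp only [LinearMap.comp_apply, LinearMap.mulRight_apply, psi_phi] at h
  rw [← h, phi_psi]

lemma coeff_opRX (m : M k) (b c a : ℕ) : opRX m (b, c, a + 1) = m (b, c, a) := by
  suffices Finsupp.lapply (b, c, a + 1) ∘ₗ opRX = Finsupp.lapply (R := k) (M := k) (b, c, a) from
    LinearMap.congr_fun this m
  apply ext_e
  intro b' c' a'
  simp [opRX_e, Finsupp.single_apply]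

lemma coeff_opRZ (m : M k) (b c a : ℕ) : opRZ q m (b, c + 1, a) = q⁻¹ ^ a * m (b, c, a) := by
  suffices Finsupp.lapply (b, c + 1, a) ∘ₗ opRZ q = q⁻¹ ^ a • Finsupp.lapply (R := k) (M := k) (b, c, a) from
    LinearMap.congr_fun this m
  apply ext_e
  intro b' c' a'
  simp only [LinearMap.comp_apply, opRZ_e, map_smul, Finsupp.lapply_apply, Finsupp.single_apply, LinearMap.smul_apply]
  by_cases h : a' = a
  · subst h; simp
  · simp [h]

lemma coeff_opZ (m : M k) (b c a : ℕ) : opZ q m (b, c + 1, a) = q⁻¹ ^ b * m (b, c, a) := by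
  suffices Finsupp.lapply (b, c + 1, a) ∘ₗ opZ q = q⁻¹ ^ b • Finsupp.lapply (R := k) (M := k) (b, c, a) from
    LinearMap.congr_fun this m
  apply ext_e
  intro b' c' a'
  simp only [LinearMap.comp_apply, opZ_e, map_smul, Finsupp.lapply_apply, Finsupp.single_apply, LinearMap.smul_apply]
  by_cases h : b' = b
  · subst h; simp
  · simp [h]

lemma coeff_opX (m : M k) (b c a : ℕ) : opX q m (b, c, a + 1) =
    q ^ b * q⁻¹ ^ c * m (b, c, a) +
      if 2 ≤ c then dseq q (b + 1) * m (b + 1, c - 2, a + 1) else 0 := by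
  suffices Finsupp.lapply (b, c, a + 1) ∘ₗ opX q =
      (q ^ b * q⁻¹ ^ c) • Finsupp.lapply (R := k) (M := k) (b, c, a) +
      (if 2 ≤ c then dseq q (b + 1) else 0) • Finsupp.lapply (R := k) (M := k) (b + 1, c - 2, a + 1) by
    have := LinearMap.congr_fun this m
    simp only [LinearMap.comp_apply, Finsupp.lapply_apply, LinearMap.add_apply, LinearMap.smul_apply, smul_eq_mul, ite_mul, zero_mul] at this
    exact this
  apply ext_e
  intro b' c' a'
  simp only [LinearMap.comp_apply, opX_e, map_add, map_smul, Finsupp.lapply_apply, Finsupp.single_apply, LinearMap.smul_apply, LinearMap.add_apply, Prod.mk.injEq, smul_eq_mul, Nat.add_right_cancel_iff]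
  congr 1
  · by_cases h : b' = b ∧ c' = c ∧ a' = a
    · obtain ⟨rfl, rfl, rfl⟩ := h; simp
    · simp [h]
  · rcases b' with _ | b'
    · simp [dseq]
    · by_cases h : b' = b ∧ c' + 2 = c ∧ a' = a + 1
      · obtain ⟨rfl, rfl, rfl⟩ := h; simp
      · simp only [Nat.add_sub_cancel, h, if_false, mul_zero]
        by_cases h2 : 2 ≤ c
        · rw [if_pos h2, if_neg (by omega), mul_zero]
        · simp [h2]

/-- the filtration -/
abbrev F (k : Type*) [Field k] (N : ℕ) : Submodule k (M k) := Finsupp.supported k k {p | p.1 < N}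

lemma e_mem {N b : ℕ} (h : b < N) (c a : ℕ) : e k b c a ∈ F k N :=
  Finsupp.single_mem_supported k 1 h

lemma F_map {N N' : ℕ} (f : M k →ₗ[k] M k) (h : ∀ b c a, b < N → f (e k b c a) ∈ F k N') {m : M k}
    (hm : m ∈ F k N) : f m ∈ F k N' := by
  unfold F at hm
  rw [Finsupp.supported_eq_span_single] at hm
  suffices Submodule.span k ((fun i => Finsupp.single i (1 : k)) '' {p : ℕ × ℕ × ℕ | p.1 < N}) ≤ (F k N').comap f from this hm
  rw [Submodule.span_le]
  rintro _ ⟨⟨b, c, a⟩, hb, rfl⟩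
  exact h b c a hb

abbrev om : Heis k q := (Heis.x k q * Heis.y k q - (q⁻¹ ^ 2) • (Heis.y k q * Heis.x k q)) * Heis.z k q

lemma rep_om_e (hq : q ≠ 0) (h3 : q - q⁻¹ ^ 2 ≠ 0) (b c a : ℕ) : ∃ u : k, u ≠ 0 ∧
    rep q hq (om q) (e k b c a) - u • e k (b + 1) (c + 1) (a + 1) ∈ F k (b + 1) := by
  refine ⟨(q - q⁻¹ ^ 2) * q⁻¹ ^ b * (q ^ b * q⁻¹ ^ (c + 1)), ?_, ?_⟩
  · have := inv_ne_zero hq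
    exact mul_ne_zero (mul_ne_zero h3 (pow_ne_zero _ this))
      (mul_ne_zero (pow_ne_zero _ hq) (pow_ne_zero _ this))
  have key : rep q hq (om q) (e k b c a) - ((q - q⁻¹ ^ 2) * q⁻¹ ^ b * (q ^ b * q⁻¹ ^ (c + 1))) •
      e k (b + 1) (c + 1) (a + 1) = e k b (c + 3) a := by
    simp only [om, map_mul, map_sub, map_smul, rep_x, rep_y, rep_z, Module.End.mul_apply,
      LinearMap.sub_apply, LinearMap.smul_apply, opX_e, opY_e, opZ_e, map_add]
    rcases b with _ | b
    · simp only [dseq, Nat.add_sub_cancel]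
      match_scalars <;> field_simp <;> try ring
    · simp only [dseq, Nat.add_sub_cancel, inv_pow]
      match_scalars <;> field_simp <;> try ring
  rw [key]
  exact e_mem (by omega) _ _

lemma rep_om_F (hq : q ≠ 0) (h3 : q - q⁻¹ ^ 2 ≠ 0) {N : ℕ} {m : M k} (hm : m ∈ F k N) :
    rep q hq (om q) m ∈ F k (N + 1) := by
  refine F_map _ ?_ hm
  intro b c a hb
  obtain ⟨u, -, h⟩ := rep_om_e q hq h3 b c a
  have h' : F k (b + 1) ≤ F k (N + 1) := Finsupp.supported_mono (fun p hp => by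
    simp only [Set.mem_ofPred_eq] at *; omega)
  have := add_mem (h' h) (Submodule.smul_mem _ u (e_mem (k := k) (show b + 1 < N + 1 by omega) (c + 1) (a + 1)))
  simpa using this

lemma rep_om_pow (hq : q ≠ 0) (h3 : q - q⁻¹ ^ 2 ≠ 0) (b c a r : ℕ) : ∃ u : k, u ≠ 0 ∧
    rep q hq (om q ^ r) (e k b c a) - u • e k (b + r) (c + r) (a + r) ∈ F k (b + r) := by
  induction r with
  | zero => exact ⟨1, one_ne_zero, by simp⟩
  | succ r ih =>
    obtain ⟨u, hu, h⟩ := ih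
    obtain ⟨v, hv, h'⟩ := rep_om_e q hq h3 (b + r) (c + r) (a + r)
    refine ⟨u * v, mul_ne_zero hu hv, ?_⟩
    have h1 := rep_om_F q hq h3 h
    have h2 := add_mem h1 (Submodule.smul_mem _ u h')
    rw [pow_succ', map_mul, Module.End.mul_apply]
    simp only [← add_assoc]
    refine (congrArg (· ∈ F k (b + r + 1)) ?_).mp h2
    rw [map_sub, map_smul]
    module

lemma gen_central (hq : q ≠ 0) (h3 : q - q⁻¹ ^ 2 ≠ 0) (ℓ : ℕ) (hℓ : ℓ ≠ 0) (h : q ^ ℓ = 1) :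
    ({Heis.x k q ^ ℓ, Heis.y k q ^ ℓ, Heis.z k q ^ ℓ, om q} : Set (Heis k q)) ⊆
      Subalgebra.center k (Heis k q) := by
  have hi : q⁻¹ ^ ℓ = 1 := by rw [inv_pow, h, inv_one]
  have hd : dseq q ℓ = 0 := by
    have := dseq_formula q ℓ
    rw [h, mul_comm 2, pow_mul, hi, one_pow, sub_self] at this
    exact (mul_eq_zero.mp this).resolve_left h3
  have hzy := rel_zy q hq
  have hxz := rel_xz q hq
  have hxy := rel_xy q
  obtain ⟨n, rfl⟩ : ∃ n, ℓ = n + 1 := ⟨ℓ - 1, by omega⟩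
  rintro w (rfl | rfl | rfl | rfl)
  · apply central_of_comm
    · exact (Commute.refl _).pow_right _
    · rw [x_y' q hxz hxy, h, hd, one_smul, zero_smul, add_zero]
    · rw [powz_y q hxz, hi, one_smul]
  · apply central_of_comm
    · rw [x_y q hzy hxy, h, hd, one_smul, zero_smul, add_zero]
    · exact (Commute.refl _).pow_right _
    · rw [zpow_y q hzy, hi, one_smul]
  · apply central_of_comm
    · rw [zpow_y q hxz, hi, one_smul]
    · rw [powz_y q hzy, hi, one_smul]
    · exact (Commute.refl _).pow_right _
  · obtain ⟨h1, h2, h3⟩ := omega_comm q hq hzy hxz hxy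
    exact central_of_comm q h1 h2 h3

lemma main (ℓ : ℕ) (hℓ : 2 ≤ ℓ) (hp : IsPrimitiveRoot q ℓ) (hq : q ≠ 0) (h3 : q - q⁻¹ ^ 2 ≠ 0) 
    (S : Subalgebra k (Heis k q)) (hS : S ≤ Subalgebra.center k (Heis k q))
    (hx : Heis.x k q ^ ℓ ∈ S) (hy : Heis.y k q ^ ℓ ∈ S) (hz : Heis.z k q ^ ℓ ∈ S) (ho : om q ∈ S)
    (N : ℕ) : ∀ w ∈ Subalgebra.center k (Heis k q), phi q hq w ∈ F k N → w ∈ S := by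
  have hmod : ∀ {i j : ℕ}, q ^ i = q ^ j → i % ℓ = j % ℓ := fun {i j} h => by
    rw [hp.eq_orderOf]
    exact (IsOfFinOrder.pow_eq_pow_iff_modEq
      (isOfFinOrder_iff_pow_eq_one.mpr ⟨ℓ, by omega, hp.pow_eq_one⟩)).mp h
  induction N with
  | zero =>
    intro w _ hw
    have : phi q hq w = 0 := by
      have h0 : {p : ℕ × ℕ × ℕ | p.1 < 0} = ∅ := by simp
      rw [F, h0, Finsupp.supported_empty] at hw
      exact hw
    rw [← psi_phi q hq w, this, map_zero]
    exact zero_mem _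
  | succ N ih =>
    intro w hw hF
    set m := phi q hq w with hm
    have hF' : ∀ b c a, N + 1 ≤ b → m (b, c, a) = 0 := by
      intro b c a hb
      rw [Finsupp.mem_supported'] at hF
      exact hF _ (by simp only [Set.mem_ofPred_eq]; omega)
    rw [Subalgebra.mem_center_iff] at hw
    have e1 : ∀ c a, m (N, c, a) ≠ 0 → a % ℓ = N % ℓ := by
      intro c a h
      have h1 := congrArg (phi q hq) (hw (Heis.z k q))
      rw [phi_mul, rep_z, phi_mul_z, ← hm] at h1
      have h2 := DFunLike.congr_fun h1 (N, c + 1, a)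
      rw [coeff_opZ, coeff_opRZ] at h2
      have h4 := mul_right_cancel₀ h h2
      rw [inv_pow, inv_pow, inv_inj] at h4
      exact (hmod h4).symm
    have e2 : ∀ c a, m (N, c, a) ≠ 0 → c % ℓ = N % ℓ := by
      intro c a h
      have h1 := congrArg (phi q hq) (hw (Heis.x k q))
      rw [phi_mul, rep_x, phi_mul_x, ← hm] at h1
      have h2 := DFunLike.congr_fun h1 (N, c, a + 1)
      rw [coeff_opX, coeff_opRX, hF' (N + 1) _ _ le_rfl, mul_zero, ite_self, add_zero] at h2
      have h4 : q ^ N * q⁻¹ ^ c = 1 := mul_right_cancel₀ h (by rw [h2, one_mul])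
      rw [inv_pow, mul_inv_eq_one₀ (pow_ne_zero _ hq)] at h4
      exact (hmod h4).symm
    have key : ∀ c a, ∃ s ∈ S, phi q hq s - m (N, c, a) • e k N c a ∈ F k N := by
      intro c a
      by_cases h : m (N, c, a) = 0
      · exact ⟨0, zero_mem _, by simp [h]⟩
      have f1 := e1 c a h
      have f2 := e2 c a h
      set r := N % ℓ with hr
      have g0 := Nat.div_add_mod N ℓ
      have g1 := Nat.div_add_mod c ℓ
      have g2 := Nat.div_add_mod a ℓ
      rw [f1] at g2
      rw [f2] at g1
      rw [← hr] at g0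
      obtain ⟨u, hu, hu'⟩ := rep_om_pow q hq h3 (ℓ * (N / ℓ)) (ℓ * (c / ℓ)) (ℓ * (a / ℓ)) r
      rw [← phi_mono q hq, ← phi_mul, g0, g1, g2] at hu'
      refine ⟨(m (N, c, a) * u⁻¹) • (om q ^ r * (Heis.y k q ^ (ℓ * (N / ℓ)) * Heis.z k q ^ (ℓ * (c / ℓ)) * Heis.x k q ^ (ℓ * (a / ℓ)))), ?_, ?_⟩
      · refine S.smul_mem (mul_mem (pow_mem ho _) (mul_mem (mul_mem ?_ ?_) ?_)) _
        · rw [pow_mul]; exact pow_mem hy _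
        · rw [pow_mul]; exact pow_mem hz _
        · rw [pow_mul]; exact pow_mem hx _
      · have := Submodule.smul_mem _ (m (N, c, a) * u⁻¹) hu'
        rwa [smul_sub, ← map_smul, smul_smul, inv_mul_cancel_right₀ hu] at this
    choose s hs1 hs2 using key
    set T := m.support.filter (fun p => p.1 = N) with hT
    set t := ∑ p ∈ T, s p.2.1 p.2.2 with ht
    have htS : t ∈ S := sum_mem fun p _ => hs1 _ _
    suffices w - t ∈ S by simpa using add_mem this htS
    apply ih
    · exact sub_mem (Subalgebra.mem_center_iff.mpr hw) (hS htS)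
    · have d1 : phi q hq t - ∑ p ∈ T, m p • Finsupp.single p 1 ∈ F k N := by
        rw [ht, map_sum, ← Finset.sum_sub_distrib]
        refine sum_mem ?_
        rintro ⟨b, c, a⟩ hp
        obtain rfl : b = N := (Finset.mem_filter.mp hp).2
        exact hs2 c a
      have d2 : m - ∑ p ∈ T, m p • Finsupp.single p 1 ∈ F k N := by
        rw [Finsupp.mem_supported']
        rintro ⟨b, c, a⟩ hb
        simp only [Set.mem_ofPred_eq, not_lt] at hb
        rw [Finsupp.sub_apply, Finsupp.finsetSum_apply]
        simp only [Finsupp.smul_apply, Finsupp.single_apply, smul_eq_mul, mul_ite, mul_one, mul_zero, Finset.sum_ite_eq']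
        split_ifs with h
        · simp
        · rcases hb.lt_or_eq with h' | h'
          · rw [hF' _ _ _ h', sub_zero]
          · rw [sub_zero]
            by_contra h0
            exact h (Finset.mem_filter.mpr ⟨Finsupp.mem_support_iff.mpr h0, h'.symm⟩)
      have := sub_mem d2 d1
      rwa [sub_sub_sub_cancel_right, hm, ← map_sub] at this

end HeisAux

/-- Let `q ∈ k` be a primitive `ℓ`th root of unity with `ℓ ≥ 2`, `ℓ ≠ 3`.
Set `Ω = xy − q⁻²yx`. Then the center of `H_q` is generated as a `k`-algebra by
`x^ℓ`, `y^ℓ`, `z^ℓ`, and `Ω·z`. -/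
theorem stmt3 (k : Type*) [Field k] [CharZero k] (q : k) (ℓ : ℕ)
    (hq : IsPrimitiveRoot q ℓ) (hℓ2 : 2 ≤ ℓ) (hℓ3 : ℓ ≠ 3) :
    Subalgebra.center k (Heis k q) =
      Algebra.adjoin k {Heis.x k q ^ ℓ, Heis.y k q ^ ℓ, Heis.z k q ^ ℓ,
        (Heis.x k q * Heis.y k q - (q⁻¹ ^ 2) • (Heis.y k q * Heis.x k q)) * Heis.z k q} := by
  have hq0 : q ≠ 0 := hq.ne_zero (by omega)
  have h3 : q - q⁻¹ ^ 2 ≠ 0 := by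
    intro h
    have h1 : q ^ 3 = 1 := by
      have h' : q = q⁻¹ ^ 2 := sub_eq_zero.mp h
      calc q ^ 3 = q ^ 2 * q := by ring
        _ = q ^ 2 * q⁻¹ ^ 2 := by rw [← h']
        _ = 1 := by rw [← mul_pow, mul_inv_cancel₀ hq0, one_pow]
    have h2 := (Nat.dvd_prime Nat.prime_three).mp (hq.dvd_of_pow_eq_one _ h1)
    omega
  have hle := HeisAux.gen_central q hq0 h3 ℓ (by omega) hq.pow_eq_one
  have hle' := Algebra.adjoin_le hle
  refine le_antisymm ?_ hle'
  intro w hw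
  refine HeisAux.main q ℓ hℓ2 hq hq0 h3 _ hle' ?_ ?_ ?_ ?_
    (((HeisAux.phi q hq0 w).support.sup fun p => p.1) + 1) w hw ?_
  · exact Algebra.subset_adjoin (by simp)
  · exact Algebra.subset_adjoin (by simp)
  · exact Algebra.subset_adjoin (by simp)
  · exact Algebra.subset_adjoin (by simp)
  · rw [Finsupp.mem_supported]
    intro p hp
    exact Nat.lt_succ_of_le (Finset.le_sup (f := fun p : ℕ × ℕ × ℕ => p.1) hp)
end
end

section
/- Suppose k is algebraically closed of characteristic 0. Let A be the three-dimensional Sklyanin algebra S(1,1,−1), i.e., the quotient of k⟨x,y,z⟩ by the relations xy + yx − z², yz + zy − x², and zx + xz − y². Then the ozone group Oz(A) is trivial: the only k-algebra automorphism of A fixing the center pointwise is the identity. -/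
noncomputable section

/-- The defining relations of the Sklyanin algebra `S(1,1,−1)`:
`xy + yx = z²`, `yz + zy = x²`, and `zx + xz = y²`
(generators `x = ι 0`, `y = ι 1`, `z = ι 2`). -/
inductive SklyRel (k : Type*) [Field k] :
    FreeAlgebra k (Fin 3) → FreeAlgebra k (Fin 3) → Prop
  | r1 : SklyRel k
      (FreeAlgebra.ι k 0 * FreeAlgebra.ι k 1 + FreeAlgebra.ι k 1 * FreeAlgebra.ι k 0)
      (FreeAlgebra.ι k 2 ^ 2)
  | r2 : SklyRel k
      (FreeAlgebra.ι k 1 * FreeAlgebra.ι k 2 + FreeAlgebra.ι k 2 * FreeAlgebra.ι k 1)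
      (FreeAlgebra.ι k 0 ^ 2)
  | r3 : SklyRel k
      (FreeAlgebra.ι k 2 * FreeAlgebra.ι k 0 + FreeAlgebra.ι k 0 * FreeAlgebra.ι k 2)
      (FreeAlgebra.ι k 1 ^ 2)

/-- The Sklyanin algebra `S(1,1,−1) = k⟨x,y,z⟩/(xy + yx − z², yz + zy − x², zx + xz − y²)`. -/
abbrev Skly (k : Type*) [Field k] := RingQuot (SklyRel k)

section Aux
open Polynomial

lemma sq_par {S : Type*} [CommRing S] [IsDomain S] (c : S) (h : Polynomial S) (hh : h ≠ 0)
    (hf : h.rootMultiplicity c = 1) (u w : Polynomial S) (e : h * u ^ 2 = w ^ 2) : u = 0 := by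
  by_contra hu
  have hw : w ≠ 0 := by
    rintro rfl
    have : h * u ^ 2 ≠ 0 := mul_ne_zero hh (pow_ne_zero _ hu)
    exact this (by rw [e]; ring)
  have h1 := congrArg (rootMultiplicity c) e
  rw [pow_two, pow_two, rootMultiplicity_mul (mul_ne_zero hh (mul_ne_zero hu hu)),
    rootMultiplicity_mul (mul_ne_zero hu hu), rootMultiplicity_mul (mul_ne_zero hw hw), hf] at h1
  omega

lemma rm_one {S : Type*} [CommRing S] [IsDomain S] (c : S) (h : Polynomial S)
    (h' : (X - C c) * h ≠ 0) (hc : h.eval c ≠ 0) :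
    ((X - C c) * h).rootMultiplicity c = 1 := by
  rw [rootMultiplicity_mul h', rootMultiplicity_X_sub_C_self, rootMultiplicity_eq_zero hc]

/-- squares in fraction field -/
lemma frac_nonsq {S : Type*} [CommRing S] [IsDomain S] (h : S)
    (H : ∀ u w : S, h * u ^ 2 = w ^ 2 → u = 0) (s t : FractionRing S)
    (e : algebraMap S (FractionRing S) h * s ^ 2 = t ^ 2) : s = 0 := by
  classical
  obtain ⟨d, hd⟩ := IsLocalization.exist_integer_multiples_of_finset (nonZeroDivisors S) {s, t}
  obtain ⟨u, hu⟩ := hd s (by simp)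
  obtain ⟨w, hw⟩ := hd t (by simp)
  rw [Algebra.smul_def] at hu hw
  have hd0 : algebraMap S (FractionRing S) d ≠ 0 := by
    simp
  have h1 : u = 0 := by
    apply H u w
    apply IsFractionRing.injective S (FractionRing S)
    simp only [map_mul, map_pow, hu, hw]
    linear_combination (algebraMap S (FractionRing S) d) ^ 2 * e
  rw [h1, map_zero] at hu
  exact (mul_eq_zero.mp hu.symm).resolve_left hd0

section
variable {F : Type*} [Field F]

lemma core_lin (α β γ : F) (hα : α ≠ 0) (hβ : β ≠ 0)
    (h1 : ∀ s t : F, α * β * s ^ 2 = t ^ 2 → s = 0)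
    (h2 : ∀ s t : F, -γ * s ^ 2 = t ^ 2 → s = 0) (s0 s1 t0 t1 l : F)
    (e2 : β * s1 ^ 2 - α * t1 ^ 2 = l * α) (e1 : β * (s0 * s1) = α * (t0 * t1))
    (e0 : β * s0 ^ 2 - α * t0 ^ 2 = l * (β * γ)) :
    s0 = 0 ∧ s1 = 0 ∧ t0 = 0 ∧ t1 = 0 := by
  have key : ∀ s t : F, β * s ^ 2 = α * t ^ 2 → s = 0 ∧ t = 0 := by
    intro s t e
    have hs : s = 0 := h1 s (α * t) (by linear_combination α * e)
    subst hs
    refine ⟨rfl, ?_⟩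
    have : α * t ^ 2 = 0 := by rw [← e]; ring
    simpa [hα] using this
  have hm : (β * s1 ^ 2 - α * t1 ^ 2) * (α ^ 2 * t0 ^ 2 + β ^ 2 * γ * s1 ^ 2) = 0 := by
    linear_combination (β^2*γ*s1^2) * e2 + (-α*β * s1^2) * e0 + α * (β * (s0*s1) + α * (t0*t1)) * e1 
  rcases mul_eq_zero.mp hm with h | h
  · obtain ⟨rfl, rfl⟩ := key s1 t1 (by linear_combination h)
    have hl : l = 0 := by
      have : l * α = 0 := by rw [← e2]; ring
      simpa [hα] using this
    subst hl
    obtain ⟨rfl, rfl⟩ := key s0 t0 (by linear_combination e0)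
    simp
  · have hs : s1 = 0 := by
      have := h2 (β * s1) (α * t0) (by linear_combination -h)
      simpa [hβ] using this
    subst hs
    have ht : t0 = 0 := by
      have : α ^ 2 * t0 ^ 2 = 0 := by linear_combination h
      simpa [hα] using this
    subst ht
    have hl : l = - t1 ^ 2 := by
      apply mul_right_cancel₀ hα
      linear_combination -e2
    have ht : t1 = 0 := by
      apply h2 t1 s0
      apply mul_left_cancel₀ hβ
      rw [hl] at e0
      linear_combination -e0
    subst ht
    have : β * s0 ^ 2 = 0 := by rw [hl] at e0; linear_combination e0
    have hs0 : s0 = 0 := by simpa [hβ] using this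
    exact ⟨hs0, rfl, rfl, rfl⟩

/-- degree-≤1 remainder form -/
lemma rem_form (α δ : F) (hα : α ≠ 0) (S : F[X]) :
    ∃ s0 s1 : F, ∃ Q : F[X], S = C s0 + C s1 * X + (C α * X ^ 2 + C δ) * Q := by
  set D : F[X] := C α * X ^ 2 + C δ with hD
  have hdeg : D.degree = 2 := by
    rw [hD]; compute_degree!
  have hD0 : D ≠ 0 := by
    intro h
    rw [h, degree_zero] at hdeg
    exact absurd hdeg (by decide)
  refine ⟨(S % D).coeff 0, (S % D).coeff 1, S / D, ?_⟩
  have h1 : (S % D).degree < 2 := by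
    rw [← hdeg]
    exact EuclideanDomain.mod_lt _ hD0
  have h2 : (S % D).degree ≤ 1 := by
    exact Order.le_of_lt_succ h1
  have h3 := Polynomial.eq_X_add_C_of_degree_le_one h2
  have h4 := EuclideanDomain.div_add_mod S D
  conv_lhs => rw [← h4, h3]
  ring

/-- A polynomial of degree `≤ 2` divisible by `D`. -/
lemma div_form (α δ : F) (hα : α ≠ 0) (c0 c1 c2 : F)
    (h : (C α * X ^ 2 + C δ : F[X]) ∣ C c2 * X ^ 2 + C c1 * X + C c0) :
    ∃ l, c2 = l * α ∧ c1 = 0 ∧ c0 = l * δ := by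
  have hdeg : (C α * X ^ 2 + C δ : F[X]).degree = 2 := by compute_degree!
  have hd : (C α * X ^ 2 + C δ : F[X]) ∣ C c1 * X + C (c0 - c2 / α * δ) := by
    have : (C c1 * X + C (c0 - c2 / α * δ) : F[X]) =
      (C c2 * X ^ 2 + C c1 * X + C c0) - C (c2 / α) * (C α * X ^ 2 + C δ) := by
      have : (C c2 : F[X]) = C (c2 / α) * C α := by rw [← C_mul]; congr 1; field_simp
      rw [this]; simp only [C_sub, C_mul]; ring
    rw [this]
    exact dvd_sub h (Dvd.intro_left _ rfl)
  have hz := Polynomial.eq_zero_of_dvd_of_degree_lt hd (by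
    rw [hdeg]; exact lt_of_le_of_lt (Polynomial.degree_linear_le) (by norm_num))
  refine ⟨c2 / α, by field_simp, ?_, ?_⟩
  · simpa using congrArg (fun p => coeff p 1) hz
  · have := congrArg (fun p => coeff p 0) hz
    simp at this
    linear_combination this

lemma core_div (α β γ : F) (hα : α ≠ 0) (hβ : β ≠ 0) (hγ : γ ≠ 0) (h20 : (2 : F) ≠ 0)
    (h1 : ∀ s t : F, α * β * s ^ 2 = t ^ 2 → s = 0)
    (h2 : ∀ s t : F, -γ * s ^ 2 = t ^ 2 → s = 0) (S T E : F[X])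
    (e : C β * S ^ 2 - C α * T ^ 2 + (C α * X ^ 2 + C (β * γ)) * E ^ 2 = 0) :
    ∃ S' T' E' : F[X], S = (C α * X ^ 2 + C (β * γ)) * S' ∧ T = (C α * X ^ 2 + C (β * γ)) * T' ∧
      E = (C α * X ^ 2 + C (β * γ)) * E' := by
  obtain ⟨s0, s1, S', hS⟩ := rem_form α (β * γ) hα S
  obtain ⟨t0, t1, T', hT⟩ := rem_form α (β * γ) hα T
  obtain ⟨e0, e1, E', hE⟩ := rem_form α (β * γ) hα E
  have hd0 : (C α * X ^ 2 + C (β * γ) : F[X]) ≠ 0 := by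
    have : (C α * X ^ 2 + C (β * γ) : F[X]).degree = 2 := by compute_degree!
    intro h; rw [h] at this; simp at this
  have d1 : (C α * X ^ 2 + C (β * γ) : F[X]) ∣ C (β * s1 ^ 2 - α * t1 ^ 2) * X ^ 2 +
      C (2 * (β * (s0 * s1) - α * (t0 * t1))) * X + C (β * s0 ^ 2 - α * t0 ^ 2) := by
    refine ⟨-E ^ 2 - C β * S' * (S + C s0 + C s1 * X) + C α * T' * (T + C t0 + C t1 * X), ?_⟩
    have two : (C 2 : F[X]) = 2 := rfl
    simp only [C_sub, C_mul, C_pow, two] at hS hT e ⊢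
    rw [hS, hT] at e
    rw [hS, hT]
    linear_combination e
  obtain ⟨l, f2, f1, f0⟩ := div_form α (β * γ) hα _ _ _ d1
  obtain ⟨rfl, rfl, rfl, rfl⟩ := core_lin α β γ hα hβ h1 h2 s0 s1 t0 t1 l f2
    (by have := (mul_eq_zero.mp f1).resolve_left h20; linear_combination this) f0
  simp only [map_zero, zero_mul, zero_add, add_zero] at hS hT
  have hE2 : E ^ 2 = (C α * X ^ 2 + C (β * γ)) * (C α * T' ^ 2 - C β * S' ^ 2) := by
    apply mul_left_cancel₀ hd0
    rw [hS, hT] at e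
    linear_combination e
  have d2 : (C α * X ^ 2 + C (β * γ) : F[X]) ∣ C (e1 ^ 2) * X ^ 2 +
      C (2 * (e0 * e1)) * X + C (e0 ^ 2) := by
    refine ⟨(C α * T' ^ 2 - C β * S' ^ 2) - E' * (E + C e0 + C e1 * X), ?_⟩
    have two : (C 2 : F[X]) = 2 := rfl
    simp only [C_mul, C_pow, two] at hE hE2 ⊢
    rw [mul_sub, ← hE2, hE]
    ring
  obtain ⟨l, f2, f1, f0⟩ := div_form α (β * γ) hα _ _ _ d2
  have : e0 = 0 ∧ e1 = 0 := by
    have f1 := (mul_eq_zero.mp f1).resolve_left h20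
    rcases mul_eq_zero.mp f1 with h | h
    · subst h
      have : l = 0 := by
        have : l * (β * γ) = 0 := by rw [← f0]; ring
        simpa [hβ, hγ] using this
      subst this
      simpa using f2
    · subst h
      have : l = 0 := by
        have : l * α = 0 := by rw [← f2]; ring
        simpa [hα] using this
      subst this
      simpa using f0
  obtain ⟨rfl, rfl⟩ := this
  simp only [map_zero, zero_mul, zero_add, add_zero] at hE
  exact ⟨S', T', E', hS, hT, hE⟩

lemma core_aniso (α β γ : F) (hα : α ≠ 0) (hβ : β ≠ 0) (hγ : γ ≠ 0) (h20 : (2 : F) ≠ 0)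
    (h1 : ∀ s t : F, α * β * s ^ 2 = t ^ 2 → s = 0)
    (h2 : ∀ s t : F, -γ * s ^ 2 = t ^ 2 → s = 0) : ∀ (n : ℕ) (S T E : F[X])
    (_ : S.natDegree + T.natDegree + E.natDegree ≤ n)
    (_ : C β * S ^ 2 - C α * T ^ 2 + (C α * X ^ 2 + C (β * γ)) * E ^ 2 = 0),
    S = 0 ∧ T = 0 ∧ E = 0 := by
  have hdeg : (C α * X ^ 2 + C (β * γ) : F[X]).natDegree = 2 := by compute_degree!
  have hd0 : (C α * X ^ 2 + C (β * γ) : F[X]) ≠ 0 := by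
    intro h; rw [h] at hdeg; simp at hdeg
  intro n
  induction n using Nat.strong_induction_on with
  | _ n ih =>
    intro S T E hn e
    by_contra hne
    obtain ⟨S', T', E', hS, hT, hE⟩ := core_div α β γ hα hβ hγ h20 h1 h2 S T E e
    have hdd : ∀ A : F[X], ((C α * X ^ 2 + C (β * γ)) * A).natDegree = A.natDegree + 2 ∨ A = 0 := by
      intro A
      by_cases hA : A = 0
      · exact Or.inr hA
      · left; rw [natDegree_mul hd0 hA, hdeg, add_comm]
    have hle : ∀ A : F[X], A.natDegree ≤ ((C α * X ^ 2 + C (β * γ)) * A).natDegree := by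
      intro A
      rcases hdd A with h | h
      · omega
      · simp [h]
    have hlt : S'.natDegree + T'.natDegree + E'.natDegree < S.natDegree + T.natDegree + E.natDegree := by
      have a1 := hle S'
      have a2 := hle T'
      have a3 := hle E'
      rw [← hS] at a1
      rw [← hT] at a2
      rw [← hE] at a3
      rcases hdd S' with h | h
      · rw [← hS] at h; omega
      rcases hdd T' with h' | h'
      · rw [← hT] at h'; omega
      rcases hdd E' with h'' | h''
      · rw [← hE] at h''; omega
      exact absurd (by simp [hS, hT, hE, h, h', h'']) hne
    obtain ⟨rfl, rfl, rfl⟩ := ih (S'.natDegree + T'.natDegree + E'.natDegree) (by omega) S' T' E' le_rfl (by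
      have : (C α * X ^ 2 + C (β * γ)) ^ 2 *
        (C β * S' ^ 2 - C α * T' ^ 2 + (C α * X ^ 2 + C (β * γ)) * E' ^ 2) = 0 := by
        rw [hS, hT, hE] at e
        linear_combination e
      exact (mul_eq_zero.mp this).resolve_left (pow_ne_zero _ hd0))
    exact hne (by simp [hS, hT, hE])
end

/-- Anisotropy of the ternary form over `B[P]`, assuming two non-square conditions in `B`. -/
lemma q_aniso_gen {B : Type*} [CommRing B] [IsDomain B] [CharZero B] (w z : B)
    (hα : 5 * z + 6 * w ≠ 0) (hβ : z - 2 * w ≠ 0) (hγ : z ^ 2 + 2 * z * w - w ^ 2 ≠ 0)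
    (H1 : ∀ u v : B, (5 * z + 6 * w) * (z - 2 * w) * u ^ 2 = v ^ 2 → u = 0)
    (H2 : ∀ u v : B, -(z ^ 2 + 2 * z * w - w ^ 2) * u ^ 2 = v ^ 2 → u = 0) (a b c : B[X])
    (h : (C w + X) * (a ^ 2 + b * c) + (C w - X) * (b ^ 2 + c * a) + C z * (c ^ 2 + a * b) = 0) :
    a = 0 ∧ b = 0 ∧ c = 0 := by
  have hi : Function.Injective (algebraMap B (FractionRing B)) :=
    IsFractionRing.injective B (FractionRing B)
  have : CharZero (FractionRing B) := charZero_of_injective_algebraMap hi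
  set α := 5 * z + 6 * w with dα
  set β := z - 2 * w with dβ
  set γ := z ^ 2 + 2 * z * w - w ^ 2 with dγ
  set i := algebraMap B (FractionRing B) with di
  have h1 : ∀ s t, i α * i β * s ^ 2 = t ^ 2 → s = 0 := by
    intro s t e
    rw [← map_mul] at e
    exact frac_nonsq (α * β) H1 s t e
  have h2 : ∀ s t, -i γ * s ^ 2 = t ^ 2 → s = 0 := by
    intro s t e
    rw [← map_neg] at e
    exact frac_nonsq (-γ) H2 s t e
  have hf : Function.Injective (Polynomial.map i) := Polynomial.map_injective i hi
  have main : C β * (C α * (a + b) - 2 * C (2 * z + w) * (a + b - c)) ^ 2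
      - C α * (C β * (a - b) - 2 * X * (a + b - c)) ^ 2 +
      (C α * X ^ 2 + C (β * γ)) * (2 * (a + b - c)) ^ 2 = 0 := by
    have t2' : (C 2 : B[X]) = 2 := rfl
    have t5' : (C 5 : B[X]) = 5 := rfl
    have t6' : (C 6 : B[X]) = 6 := rfl
    simp only [dα, dβ, dγ, C_mul, C_add, C_sub, C_pow, t2', t5', t6']
    linear_combination 4 * (5 * C z + 6 * C w) * (C z - 2 * C w) * h
  generalize hS : C α * (a + b) - 2 * C (2 * z + w) * (a + b - c) = S at main
  generalize hT : C β * (a - b) - 2 * X * (a + b - c) = T at main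
  generalize hE : 2 * (a + b - c) = E at main
  have main2 := congrArg (Polynomial.map i) main
  simp only [Polynomial.map_add, Polynomial.map_sub, Polynomial.map_mul, Polynomial.map_pow,
    Polynomial.map_zero, map_C, map_X, map_mul i] at main2
  obtain ⟨q1, q2, q3⟩ := core_aniso (i α) (i β) (i γ) ((map_ne_zero_iff i hi).mpr hα)
    ((map_ne_zero_iff i hi).mpr hβ) ((map_ne_zero_iff i hi).mpr hγ) (by norm_num) h1 h2 _
    (map i S) (map i T) (map i E) le_rfl main2
  have q1 : S = 0 := hf (by simpa using q1)
  have q2 : T = 0 := hf (by simpa using q2)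
  have q3 : E = 0 := hf (by simpa using q3)
  have two : (2 : B[X]) ≠ 0 := by norm_num
  have he : a + b - c = 0 := by
    rw [q3] at hE
    exact (mul_eq_zero.mp hE).resolve_left two
  have hs : a + b = 0 := by
    rw [q1, he] at hS
    have : C α * (a + b) = 0 := by linear_combination hS
    exact (mul_eq_zero.mp this).resolve_left (by simpa using hα)
  have ht : a - b = 0 := by
    rw [q2, he] at hT
    have : C β * (a - b) = 0 := by linear_combination hT
    exact (mul_eq_zero.mp this).resolve_left (by simpa using hβ)
  refine ⟨?_, ?_, ?_⟩
  · apply mul_left_cancel₀ two; linear_combination hs + ht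
  · apply mul_left_cancel₀ two; linear_combination hs - ht
  · linear_combination hs - he

/-- The ring `k[W][Z]`. -/
def SB (k : Type*) [Field k] := Polynomial (Polynomial k)
noncomputable instance (k : Type*) [Field k] : CommRing (SB k) :=
  inferInstanceAs (CommRing (Polynomial (Polynomial k)))
instance (k : Type*) [Field k] : IsDomain (SB k) :=
  inferInstanceAs (IsDomain (Polynomial (Polynomial k)))
instance (k : Type*) [Field k] [CharZero k] : CharZero (SB k) :=
  inferInstanceAs (CharZero (Polynomial (Polynomial k)))
noncomputable def bW (k : Type*) [Field k] : SB k := (C X : Polynomial (Polynomial k))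
noncomputable def bZ (k : Type*) [Field k] : SB k := (X : Polynomial (Polynomial k))
noncomputable def bC (k : Type*) [Field k] : k →+* SB k :=
  ((C : Polynomial k →+* Polynomial (Polynomial k)).comp C)

/-- The ring `k[W][Z][P]`. -/
def SR (k : Type*) [Field k] := Polynomial (SB k)
noncomputable instance (k : Type*) [Field k] : CommRing (SR k) :=
  inferInstanceAs (CommRing (Polynomial (SB k)))
instance (k : Type*) [Field k] : IsDomain (SR k) :=
  inferInstanceAs (IsDomain (Polynomial (SB k)))
instance (k : Type*) [Field k] [CharZero k] : CharZero (SR k) :=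
  inferInstanceAs (CharZero (Polynomial (SB k)))
noncomputable def rP (k : Type*) [Field k] : SR k := (X : Polynomial (SB k))
noncomputable def rW (k : Type*) [Field k] : SR k := (C (bW k) : Polynomial (SB k))
noncomputable def rZ (k : Type*) [Field k] : SR k := (C (bZ k) : Polynomial (SB k))
noncomputable def rX (k : Type*) [Field k] : SR k := rW k + rP k
noncomputable def rY (k : Type*) [Field k] : SR k := rW k - rP k
noncomputable def rC (k : Type*) [Field k] : k →+* SR k :=
  ((C : SB k →+* Polynomial (SB k)).comp (bC k))
noncomputable instance (k : Type*) [Field k] : Algebra k (SR k) := (rC k).toAlgebra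

/-- Evaluation of elements of `SR`. -/
lemma SR_exists_hom (k : Type*) [Field k] {T : Type*} [CommRing T] (f : k →+* T) (w z p : T) :
    ∃ g : SR k →+* T, (∀ c, g (rC k c) = f c) ∧ g (rW k) = w ∧ g (rZ k) = z ∧ g (rP k) = p := by
  let g1 : Polynomial (Polynomial k) →+* T := eval₂RingHom (eval₂RingHom f w) z
  let g1' : SB k →+* T := g1
  let g : Polynomial (SB k) →+* T := eval₂RingHom g1' p
  refine ⟨g, fun c => ?_, ?_, ?_, ?_⟩
  · change eval₂ g1' p (C (bC k c)) = _
    rw [eval₂_C]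
    change eval₂ (eval₂RingHom f w) z (C (C c)) = _
    simp
  · change eval₂ g1' p (C (bW k)) = _
    rw [eval₂_C]
    change eval₂ (eval₂RingHom f w) z (C X) = _
    simp
  · change eval₂ g1' p (C (bZ k)) = _
    rw [eval₂_C]
    change eval₂ (eval₂RingHom f w) z X = _
    simp
  · change eval₂ g1' p X = _
    simp

lemma SR_hom_ext (k : Type*) [Field k] {T : Type*} [Ring T] (f g : SR k →+* T)
    (hc : ∀ c, f (rC k c) = g (rC k c)) (hw : f (rW k) = g (rW k)) (hz : f (rZ k) = g (rZ k))
    (hp : f (rP k) = g (rP k)) : f = g := by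
  apply Polynomial.ringHom_ext (R := SB k)
  · suffices h : (RingHom.comp f (C : SB k →+* Polynomial (SB k))) = (RingHom.comp g (C : SB k →+* Polynomial (SB k))) by
      intro a; exact RingHom.congr_fun h a
    apply Polynomial.ringHom_ext (R := Polynomial k)
    · suffices h : (RingHom.comp (RingHom.comp f (C : SB k →+* Polynomial (SB k))) (C : Polynomial k →+* Polynomial (Polynomial k))) = (RingHom.comp (RingHom.comp g (C : SB k →+* Polynomial (SB k))) (C : Polynomial k →+* Polynomial (Polynomial k))) by
        intro a; exact RingHom.congr_fun h a
      apply Polynomial.ringHom_ext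
      · exact hc
      · exact hw
    · exact hz
  · exact hp

lemma q_aniso (k : Type*) [Field k] [CharZero k] [IsAlgClosed k] (a b c : SR k)
    (h : rX k * (a ^ 2 + b * c) + rY k * (b ^ 2 + c * a) + rZ k * (c ^ 2 + a * b) = 0) :
    a = 0 ∧ b = 0 ∧ c = 0 := by
  obtain ⟨r, hr⟩ := IsAlgClosed.exists_pow_nat_eq (2 : k) (n := 2) (by norm_num)
  have hr0 : r ≠ 0 := by rintro rfl; norm_num at hr
  have hXn : ∀ m : k, m ≠ 0 → (C m * X : k[X]) ≠ 0 := by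
    intro m hm; simp [hm]
  have hαe : (5 * X + 6 * C X : k[X][X]).eval (2 * X : k[X]) ≠ 0 := by
    have : (5 * X + 6 * C X : k[X][X]).eval (2 * X : k[X]) = C (16 : k) * X := by
      have : (C 16 : k[X]) = 16 := rfl
      simp [this]; ring
    rw [this]; exact hXn _ (by norm_num)
  have hα : (5 * X + 6 * C X : k[X][X]) ≠ 0 := by intro h; rw [h] at hαe; simp at hαe
  have hβf : (X - 2 * C X : k[X][X]) = X - C (2 * X : k[X]) := by
    have : (C 2 : k[X][X]) = 2 := rfl
    simp [this]
  have hβ : (X - 2 * C X : k[X][X]) ≠ 0 := by rw [hβf]; exact X_sub_C_ne_zero _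
  have hγf : -(X ^ 2 + 2 * X * C X - (C X) ^ 2 : k[X][X]) =
      (X - C (C (-1 + r) * X : k[X])) * -(X - C (C (-1 - r) * X : k[X])) := by
    have : (C (C r) : k[X][X]) ^ 2 = 2 := by rw [← C_pow, ← C_pow, hr]; rfl
    simp only [C_mul, C_add, C_sub, C_neg, C_1]
    linear_combination (-(C X)^2) * this
  have hne : (X - C (C (-1 + r) * X : k[X])) * -(X - C (C (-1 - r) * X : k[X])) ≠ 0 :=
    mul_ne_zero (X_sub_C_ne_zero _) (neg_ne_zero.mpr (X_sub_C_ne_zero _))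
  have H3 : (X ^ 2 + 2 * X * C X - (C X) ^ 2 : k[X][X]) ≠ 0 := by
    intro h
    rw [← hγf, h] at hne; simp at hne
  have H1 : ∀ u v : k[X][X], (5 * X + 6 * C X) * (X - 2 * C X) * u ^ 2 = v ^ 2 → u = 0 := by
    rw [mul_comm (5 * X + 6 * C X), hβf]
    have hne : (X - C (2 * X : k[X])) * (5 * X + 6 * C X) ≠ 0 :=
      mul_ne_zero (X_sub_C_ne_zero _) hα
    exact fun u w e => sq_par (2 * X : k[X]) _ hne (rm_one _ _ hne hαe) u w e
  have H2 : ∀ u v : k[X][X], -(X ^ 2 + 2 * X * C X - (C X) ^ 2) * u ^ 2 = v ^ 2 → u = 0 := by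
    rw [hγf]
    refine fun u w e => sq_par (C (-1 + r) * X : k[X]) _ hne (rm_one _ _ hne ?_) u w e
    have : (-(X - C (C (-1 - r) * X : k[X]))).eval (C (-1 + r) * X : k[X]) = C (-2 * r) * X := by
      have : (C 2 : k[X]) = 2 := rfl
      rw [eval_neg, eval_sub, eval_X, eval_C]
      simp only [C_add, C_sub, C_neg, C_mul, C_1, this]
      ring
    rw [this]
    exact hXn _ (by simpa using hr0)
  exact q_aniso_gen (B := SB k) (bW k) (bZ k) hα hβ H3 H1 H2 a b c h

/-- The linear forms `X, Y, Z` are independent over `k`. -/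
lemma rXYZ_indep (k : Type*) [Field k] [CharZero k] (a b c : k)
    (h : rC k a * rX k + rC k b * rY k + rC k c * rZ k = 0) : a = 0 ∧ b = 0 ∧ c = 0 := by
  obtain ⟨g, g1, g2, g3, g4⟩ := SR_exists_hom k (RingHom.id k) 1 0 1
  obtain ⟨f, f1, f2, f3, f4⟩ := SR_exists_hom k (RingHom.id k) 1 0 (-1)
  obtain ⟨e, e1, e2, e3, e4⟩ := SR_exists_hom k (RingHom.id k) 0 1 0
  have hg := congrArg g h
  have hf := congrArg f h
  have he := congrArg e h
  simp only [rX, rY, map_add, map_sub, map_mul, map_zero, g1, g2, g3, g4, RingHom.id_apply] at hg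
  simp only [rX, rY, map_add, map_sub, map_mul, map_zero, f1, f2, f3, f4, RingHom.id_apply] at hf
  simp only [rX, rY, map_add, map_sub, map_mul, map_zero, e1, e2, e3, e4, RingHom.id_apply] at he
  refine ⟨by linear_combination hg / 2, by linear_combination hf / 2, by linear_combination he⟩

lemma disc_ne (k : Type*) [Field k] [CharZero k] :
    rX k ^ 3 + rY k ^ 3 + rZ k ^ 3 - 5 * rX k * rY k * rZ k ≠ 0 := by
  intro h
  obtain ⟨e, e1, e2, e3, e4⟩ := SR_exists_hom k (RingHom.id k) 0 1 0
  have he := congrArg e h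
  simp [rX, rY, map_add, map_sub, map_mul, map_zero, e2, e3, e4] at he
set_option linter.unusedSectionVars false
set_option linter.unusedSimpArgs false
section Model
variable {R : Type*} [CommRing R] (x y z : R)

/-- Left multiplication by `x` in the basis `1, x, y, z, xy, xz, yz, xyz`. -/
def Lx : Module.End R (Fin 8 → R) where
  toFun v := ![x * v 1, v 0, x * v 4, x * v 5, v 2, v 3, x * v 7, v 6]
  map_add' u v := by ext i; fin_cases i <;> simp <;> ring
  map_smul' c v := by ext i; fin_cases i <;> simp <;> ring

/-- Left multiplication by `y`. -/
def Ly : Module.End R (Fin 8 → R) where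
  toFun v := ![z * v 1 + y * v 2, -y * v 4, v 0 + z * v 4, z * v 5 + y * v 6, -v 1, -y * v 7,
    v 3 + z * v 7, -v 5]
  map_add' u v := by ext i; fin_cases i <;> simp <;> ring
  map_smul' c v := by ext i; fin_cases i <;> simp <;> ring

/-- Left multiplication by `z`. -/
def Lz : Module.End R (Fin 8 → R) where
  toFun v := ![y * v 1 + x * v 2 + z * v 3, -x * v 4 - z * v 5, y * v 4 - z * v 6,
    v 0 + y * v 5 + x * v 6, z * v 7, -v 1 - x * v 7, -v 2 + y * v 7, v 4]
  map_add' u v := by ext i; fin_cases i <;> simp <;> ring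
  map_smul' c v := by ext i; fin_cases i <;> simp <;> ring

lemma Lx_apply (v : Fin 8 → R) :
    Lx x v = ![x * v 1, v 0, x * v 4, x * v 5, v 2, v 3, x * v 7, v 6] := rfl
lemma Ly_apply (v : Fin 8 → R) :
    Ly y z v = ![z * v 1 + y * v 2, -y * v 4, v 0 + z * v 4, z * v 5 + y * v 6, -v 1, -y * v 7,
    v 3 + z * v 7, -v 5] := rfl
lemma Lz_apply (v : Fin 8 → R) :
    Lz x y z v = ![y * v 1 + x * v 2 + z * v 3, -x * v 4 - z * v 5, y * v 4 - z * v 6,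
    v 0 + y * v 5 + x * v 6, z * v 7, -v 1 - x * v 7, -v 2 + y * v 7, v 4] := rfl

lemma Lx_sq : Lx x * Lx x = algebraMap R _ x := by
  refine LinearMap.ext fun v => ?_
  ext i; fin_cases i <;> simp [Lx_apply]
lemma Ly_sq : Ly y z * Ly y z = algebraMap R _ y := by
  refine LinearMap.ext fun v => ?_
  ext i; fin_cases i <;> simp [Ly_apply] <;> ring
lemma Lz_sq : Lz x y z * Lz x y z = algebraMap R _ z := by
  refine LinearMap.ext fun v => ?_
  ext i; fin_cases i <;> simp [Lz_apply] <;> ring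
lemma Lxy : Lx x * Ly y z + Ly y z * Lx x = algebraMap R _ z := by
  refine LinearMap.ext fun v => ?_
  ext i; fin_cases i <;> simp [Lx_apply, Ly_apply] <;> ring
lemma Lyz : Ly y z * Lz x y z + Lz x y z * Ly y z = algebraMap R _ x := by
  refine LinearMap.ext fun v => ?_
  ext i; fin_cases i <;> simp [Lz_apply, Ly_apply] <;> ring
lemma Lzx : Lz x y z * Lx x + Lx x * Lz x y z = algebraMap R _ y := by
  refine LinearMap.ext fun v => ?_
  ext i; fin_cases i <;> simp [Lz_apply, Lx_apply] <;> ring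

lemma odd_sq [IsDomain R] [CharZero R]
    (H : ∀ a b c : R, x * (a ^ 2 + b * c) + y * (b ^ 2 + c * a) + z * (c ^ 2 + a * b) = 0 →
      a = 0 ∧ b = 0 ∧ c = 0)
    (hd : x ^ 3 + y ^ 3 + z ^ 3 - 5 * x * y * z ≠ 0) (a b c r : R)
    (h : (a • Lx x + b • Ly y z + c • Lz x y z + r • (Lx x * (Ly y z * Lz x y z)))
      ![0, a, b, c, 0, 0, 0, r] = 0) : a = 0 ∧ b = 0 ∧ c = 0 ∧ r = 0 := by
  have h0 := congrFun h 0
  have h4 := congrFun h 4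
  have h5 := congrFun h 5
  have h6 := congrFun h 6
  simp [Lx_apply, Ly_apply, Lz_apply] at h0 h4 h5 h6
  have two : (2 : R) ≠ 0 := by norm_num
  have key : r * (x * ((2 * a + x * r) ^ 2 + (2 * b - y * r) * (2 * c + z * r))
      + y * ((2 * b - y * r) ^ 2 + (2 * c + z * r) * (2 * a + x * r))
      + z * ((2 * c + z * r) ^ 2 + (2 * a + x * r) * (2 * b - y * r))) = 0 := by
    linear_combination ((2 * a + x * r) * h6 - (2 * b - y * r) * h5 + (2 * c + z * r) * h4)
  have key0 : (x * ((2 * a + x * r) ^ 2 + (2 * b - y * r) * (2 * c + z * r))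
      + y * ((2 * b - y * r) ^ 2 + (2 * c + z * r) * (2 * a + x * r))
      + z * ((2 * c + z * r) ^ 2 + (2 * a + x * r) * (2 * b - y * r)))
      + r ^ 2 * (x ^ 3 + y ^ 3 + z ^ 3 - 5 * x * y * z) = 0 := by
    linear_combination 4 * h0 + 2 * z * h4 + 2 * y * h5 + 2 * x * h6
  have hr : r = 0 := by
    rcases mul_eq_zero.mp key with h | h
    · exact h
    · rw [h, zero_add] at key0
      simpa [hd] using key0
  subst hr
  have := H (2 * a) (2 * b) (2 * c) (by linear_combination key0)
  simpa [two] using this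

lemma even_sq [IsDomain R] [CharZero R]
    (H : ∀ a b c : R, x * (a ^ 2 + b * c) + y * (b ^ 2 + c * a) + z * (c ^ 2 + a * b) = 0 →
      a = 0 ∧ b = 0 ∧ c = 0)
    (hd : x ^ 3 + y ^ 3 + z ^ 3 - 5 * x * y * z ≠ 0) (a b c r : R)
    (h : (r • (1 : Module.End R (Fin 8 → R)) + a • (Lx x * Ly y z) + b • (Lx x * Lz x y z)
        + c • (Ly y z * Lz x y z))
      ![r, 0, 0, 0, a, b, c, 0] = 0) : a = 0 ∧ b = 0 ∧ c = 0 ∧ r = 0 := by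
  have h0 := congrFun h 0
  have h4 := congrFun h 4
  have h5 := congrFun h 5
  have h6 := congrFun h 6
  simp [Lx_apply, Ly_apply, Lz_apply] at h0 h4 h5 h6
  have two : (2 : R) ≠ 0 := by norm_num
  have k4 : (2 * r + z * a + y * b + x * c) * a = 0 := by linear_combination h4
  have k5 : (2 * r + z * a + y * b + x * c) * b = 0 := by linear_combination h5
  have k6 : (2 * r + z * a + y * b + x * c) * c = 0 := by linear_combination h6
  by_cases hs : 2 * r + z * a + y * b + x * c = 0
  · have hq : x * ((((4*y*z-x^2)*c - (x*y-2*z^2)*b + (z*x-2*y^2)*a)) ^ 2 +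
        ((x*y-2*z^2)*c - (4*x*z-y^2)*b + (y*z-2*x^2)*a) *
        ((z*x-2*y^2)*c - (y*z-2*x^2)*b + (4*x*y-z^2)*a))
      + y * (((x*y-2*z^2)*c - (4*x*z-y^2)*b + (y*z-2*x^2)*a) ^ 2 +
        ((z*x-2*y^2)*c - (y*z-2*x^2)*b + (4*x*y-z^2)*a) *
        ((4*y*z-x^2)*c - (x*y-2*z^2)*b + (z*x-2*y^2)*a))
      + z * (((z*x-2*y^2)*c - (y*z-2*x^2)*b + (4*x*y-z^2)*a) ^ 2 +
        ((4*y*z-x^2)*c - (x*y-2*z^2)*b + (z*x-2*y^2)*a) *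
        ((x*y-2*z^2)*c - (4*x*z-y^2)*b + (y*z-2*x^2)*a)) = 0 := by
      linear_combination (x ^ 3 + y ^ 3 + z ^ 3 - 5 * x * y * z) * (4 * h0 -
        (2 * r - (z * a + y * b + x * c)) * hs)
    obtain ⟨u1, u2, u3⟩ := H _ _ _ hq
    have e1 : c = 0 := by
      have : (2 * (x ^ 3 + y ^ 3 + z ^ 3 - 5 * x * y * z)) * c = 0 := by
        linear_combination -(2 * x * u1 + z * u2 + y * u3)
      simpa [hd] using this
    have e2 : b = 0 := by
      have : (2 * (x ^ 3 + y ^ 3 + z ^ 3 - 5 * x * y * z)) * b = 0 := by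
        linear_combination (z * u1 + 2 * y * u2 + x * u3)
      simpa [hd] using this
    have e3 : a = 0 := by
      have : (2 * (x ^ 3 + y ^ 3 + z ^ 3 - 5 * x * y * z)) * a = 0 := by
        linear_combination -(y * u1 + x * u2 + 2 * z * u3)
      simpa [hd] using this
    subst e1 e2 e3
    refine ⟨rfl, rfl, rfl, ?_⟩
    simpa using hs
  · have e1 := (mul_eq_zero.mp k4).resolve_left hs
    have e2 := (mul_eq_zero.mp k5).resolve_left hs
    have e3 := (mul_eq_zero.mp k6).resolve_left hs
    subst e1 e2 e3
    refine ⟨rfl, rfl, rfl, ?_⟩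
    simpa using h0

end Model

section Alg
variable (k : Type*) [Field k]

/-- A ring structure on `Skly k` extending its semiring structure transparently. -/
@[reducible] instance (priority := 2000) sklyRing : Ring (Skly k) := Algebra.semiringToRing k
@[reducible] instance (priority := 2000) sklyNeg : Neg (Skly k) := (sklyRing k).toNeg
@[reducible] instance (priority := 2000) sklySub : Sub (Skly k) := (sklyRing k).toSub

/-- The generators. -/
def gX (i : Fin 3) : Skly k := RingQuot.mkAlgHom k (SklyRel k) (FreeAlgebra.ι k i)

lemma rel1 : gX k 0 * gX k 1 + gX k 1 * gX k 0 = gX k 2 ^ 2 := by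
  have := RingQuot.mkAlgHom_rel k (SklyRel.r1 (k := k))
  simpa [gX] using this
lemma rel2 : gX k 1 * gX k 2 + gX k 2 * gX k 1 = gX k 0 ^ 2 := by
  have := RingQuot.mkAlgHom_rel k (SklyRel.r2 (k := k))
  simpa [gX] using this
lemma rel3 : gX k 2 * gX k 0 + gX k 0 * gX k 2 = gX k 1 ^ 2 := by
  have := RingQuot.mkAlgHom_rel k (SklyRel.r3 (k := k))
  simpa [gX] using this

variable {k}

lemma skly_induction {p : Skly k → Prop} (h0 : ∀ c, p (algebraMap k _ c)) (h1 : ∀ i, p (gX k i))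
    (hm : ∀ a b, p a → p b → p (a * b)) (ha : ∀ a b, p a → p b → p (a + b)) (a : Skly k) : p a := by
  obtain ⟨f, rfl⟩ := RingQuot.mkAlgHom_surjective k (SklyRel k) a
  induction f using FreeAlgebra.induction with
  | grade0 r => rw [AlgHom.commutes]; exact h0 r
  | grade1 x => exact h1 x
  | mul a b ha hb => rw [map_mul]; exact hm _ _ ha hb
  | add a b ha' hb' => rw [map_add]; exact ha _ _ ha' hb'

lemma skly_lift {B : Type*} [Semiring B] [Algebra k B] (a b c : B) (h1 : a * b + b * a = c ^ 2)
    (h2 : b * c + c * b = a ^ 2) (h3 : c * a + a * c = b ^ 2) :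
    ∃ f : Skly k →ₐ[k] B, f (gX k 0) = a ∧ f (gX k 1) = b ∧ f (gX k 2) = c := by
  refine ⟨RingQuot.liftAlgHom k ⟨FreeAlgebra.lift k ![a, b, c], ?_⟩, ?_, ?_, ?_⟩
  · intro u v h
    cases h
    · simpa using h1
    · simpa using h2
    · simpa using h3
  all_goals simp [gX]

lemma sq_comm_aux {A : Type*} [Ring A] (h2 : ∀ a : A, a + a = 0 → a = 0) (a b c : A)
    (r1 : a * b + b * a = c ^ 2) (r2 : b * c + c * b = a ^ 2) (r3 : c * a + a * c = b ^ 2) :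
    a ^ 2 * b = b * a ^ 2 := by
  have e1 : a ^ 2 * b - b * a ^ 2 = c * b ^ 2 - b ^ 2 * c := by rw [← r2]; noncomm_ring
  have e2 : c * b ^ 2 - b ^ 2 * c = c ^ 2 * a - a * c ^ 2 := by rw [← r3]; noncomm_ring
  have e3 : c ^ 2 * a - a * c ^ 2 = -(a ^ 2 * b - b * a ^ 2) := by rw [← r1]; noncomm_ring
  have := h2 (a ^ 2 * b - b * a ^ 2) (by
    nth_rewrite 1 [e1]
    rw [e2, e3]; abel)
  exact sub_eq_zero.mp this

lemma skly_two [CharZero k] (a : Skly k) (h : a + a = 0) : a = 0 := by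
  have h' : (2 : k) • a = 0 := by rw [two_smul, h]
  have : ((2 : k)⁻¹ * 2) • a = 0 := by rw [mul_smul, h', smul_zero]
  rwa [inv_mul_cancel₀ two_ne_zero, one_smul] at this

lemma mem_center_of [CharZero k] (a : Skly k) (h : ∀ i, gX k i * a = a * gX k i) :
    a ∈ Subalgebra.center k (Skly k) := by
  rw [Subalgebra.mem_center_iff]
  intro b
  induction b using skly_induction with
  | h0 c => exact Algebra.commutes c a
  | h1 i => exact h i
  | hm u v hu hv => rw [mul_assoc, hv, ← mul_assoc, hu, mul_assoc]
  | ha u v hu hv => rw [add_mul, mul_add, hu, hv]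

lemma sq_mem_center [CharZero k] (i : Fin 3) : gX k i ^ 2 ∈ Subalgebra.center k (Skly k) := by
  have r1 := rel1 k
  have r2 := rel2 k
  have r3 := rel3 k
  apply mem_center_of
  have q1 : gX k 1 * gX k 0 + gX k 0 * gX k 1 = gX k 2 ^ 2 := by rw [← r1, add_comm]
  have q2 : gX k 2 * gX k 1 + gX k 1 * gX k 2 = gX k 0 ^ 2 := by rw [← r2, add_comm]
  have q3 : gX k 0 * gX k 2 + gX k 2 * gX k 0 = gX k 1 ^ 2 := by rw [← r3, add_comm]
  intro j
  symm
  fin_cases i <;> fin_cases j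
  · exact (pow_succ _ _).symm.trans (pow_succ' _ _)
  · exact sq_comm_aux skly_two _ _ _ r1 r2 r3
  · exact sq_comm_aux skly_two _ _ _ q3 q2 q1
  · exact sq_comm_aux skly_two _ _ _ q1 q3 q2
  · exact (pow_succ _ _).symm.trans (pow_succ' _ _)
  · exact sq_comm_aux skly_two _ _ _ r2 r3 r1
  · exact sq_comm_aux skly_two _ _ _ r3 r1 r2
  · exact sq_comm_aux skly_two _ _ _ q2 q1 q3
  · exact (pow_succ _ _).symm.trans (pow_succ' _ _)

variable [CharZero k]

lemma exists_rho : ∃ ρ : SR k →+* Skly k, (∀ r a, ρ r * a = a * ρ r) ∧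
    (∀ c, ρ (rC k c) = algebraMap k _ c) ∧ ρ (rX k) = gX k 0 ^ 2 ∧ ρ (rY k) = gX k 1 ^ 2 ∧
    ρ (rZ k) = gX k 2 ^ 2 ∧ ρ (rW k) = (2 : k)⁻¹ • (gX k 0 ^ 2 + gX k 1 ^ 2) ∧
    ρ (rP k) = (2 : k)⁻¹ • (gX k 0 ^ 2 - gX k 1 ^ 2) := by
  let sx : Subalgebra.center k (Skly k) := ⟨_, sq_mem_center 0⟩
  let sy : Subalgebra.center k (Skly k) := ⟨_, sq_mem_center 1⟩
  let sz : Subalgebra.center k (Skly k) := ⟨_, sq_mem_center 2⟩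
  obtain ⟨g, g1, g2, g3, g4⟩ := SR_exists_hom k (algebraMap k (Subalgebra.center k (Skly k)))
    ((2 : k)⁻¹ • (sx + sy)) sz ((2 : k)⁻¹ • (sx - sy))
  have hX : g (rX k) = sx := by
    rw [rX, map_add, g2, g4, ← smul_add]
    rw [show sx + sy + (sx - sy) = (2 : k) • sx by rw [two_smul]; abel, smul_smul,
      inv_mul_cancel₀ two_ne_zero, one_smul]
  have hY : g (rY k) = sy := by
    have e : g (rX k) + g (rY k) = sx + sy := by
      rw [← map_add, show rX k + rY k = rW k + rW k by rw [rX, rY]; abel, map_add, g2, ← two_smul k,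
        smul_smul, mul_inv_cancel₀ two_ne_zero, one_smul]
    rw [hX] at e
    exact add_left_cancel e
  refine ⟨(Subalgebra.center k (Skly k)).subtype.comp g, ?_, ?_, ?_, ?_, ?_, ?_, ?_⟩
  · intro r a
    exact ((Subalgebra.mem_center_iff.mp (g r).2) a).symm
  · intro c
    change ((g (rC k c) : Subalgebra.center k (Skly k)) : Skly k) = _
    rw [g1]; rfl
  · change ((g _ : Subalgebra.center k (Skly k)) : Skly k) = _
    rw [hX]
  · change ((g _ : Subalgebra.center k (Skly k)) : Skly k) = _
    rw [hY]
  · change ((g _ : Subalgebra.center k (Skly k)) : Skly k) = _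
    rw [g3]
  · change ((g _ : Subalgebra.center k (Skly k)) : Skly k) = _
    rw [g2]; rfl
  · change ((g _ : Subalgebra.center k (Skly k)) : Skly k) = _
    rw [g4]; rfl

variable (k) in
def rho : SR k →+* Skly k := Classical.choose (exists_rho (k := k))
variable (k) in
lemma rho_spec : (∀ r a, rho k r * a = a * rho k r) ∧
    (∀ c, rho k (rC k c) = algebraMap k _ c) ∧ rho k (rX k) = gX k 0 ^ 2 ∧
    rho k (rY k) = gX k 1 ^ 2 ∧
    rho k (rZ k) = gX k 2 ^ 2 ∧ rho k (rW k) = (2 : k)⁻¹ • (gX k 0 ^ 2 + gX k 1 ^ 2) ∧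
    rho k (rP k) = (2 : k)⁻¹ • (gX k 0 ^ 2 - gX k 1 ^ 2) := Classical.choose_spec exists_rho

/-- Two maps out of `Skly` that agree on the squares agree on the image of `SR`. -/
lemma rho_ext {T : Type*} [Ring T] (f : Skly k →+* T) (g : SR k →+* T)
    (hc : ∀ c, f (algebraMap k _ c) = g (rC k c)) (hx : f (gX k 0 ^ 2) = g (rX k))
    (hy : f (gX k 1 ^ 2) = g (rY k)) (hz : f (gX k 2 ^ 2) = g (rZ k)) (r : SR k) :
    f (rho k r) = g r := by
  obtain ⟨-, s1, sx, sy, sz, sw, sp⟩ := rho_spec k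
  have hh : rC k (2 : k)⁻¹ * 2 = 1 := by
    have : (2 : SR k) = rC k 2 := (map_ofNat (rC k) 2).symm
    rw [this, ← map_mul, inv_mul_cancel₀ two_ne_zero, map_one]
  have hw : rC k (2 : k)⁻¹ * (rX k + rY k) = rW k := by
    rw [rX, rY]; linear_combination rW k * hh
  have hp : rC k (2 : k)⁻¹ * (rX k - rY k) = rP k := by
    rw [rX, rY]; linear_combination rP k * hh
  refine RingHom.congr_fun (SR_hom_ext k (f.comp (rho k)) g ?_ ?_ ?_ ?_) r
  · intro c; rw [RingHom.comp_apply, s1, hc]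
  · rw [RingHom.comp_apply, sw, Algebra.smul_def, map_mul, map_add, hc, hx, hy, ← map_add, ← map_mul, hw]
  · rw [RingHom.comp_apply, sz, hz]
  · rw [RingHom.comp_apply, sp, Algebra.smul_def, map_mul, map_sub, hc, hx, hy, ← map_sub, ← map_mul, hp]

instance rhoAlg : Algebra (SR k) (Skly k) := (rho k).toAlgebra' (rho_spec k).1

lemma rsmul_def (r : SR k) (a : Skly k) : r • a = rho k r * a := rfl

def Phi (v : Fin 8 → SR k) : Skly k :=
  v 0 • (1 : Skly k) + v 1 • gX k 0 + v 2 • gX k 1 + v 3 • gX k 2 + v 4 • (gX k 0 * gX k 1)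
    + v 5 • (gX k 0 * gX k 2) + v 6 • (gX k 1 * gX k 2) + v 7 • (gX k 0 * (gX k 1 * gX k 2))

lemma exists_phi : ∃ φ : Skly k →ₐ[k] Module.End (SR k) (Fin 8 → SR k),
    φ (gX k 0) = Lx (rX k) ∧ φ (gX k 1) = Ly (rY k) (rZ k) ∧
    φ (gX k 2) = Lz (rX k) (rY k) (rZ k) := by
  apply skly_lift
  · rw [Lxy, pow_two, Lz_sq]
  · rw [Lyz, pow_two, Lx_sq]
  · rw [Lzx, pow_two, Ly_sq]

variable (k) in
def phi : Skly k →ₐ[k] Module.End (SR k) (Fin 8 → SR k) := Classical.choose exists_phi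
lemma phi0 : phi k (gX k 0) = Lx (rX k) := (Classical.choose_spec exists_phi).1
lemma phi1 : phi k (gX k 1) = Ly (rY k) (rZ k) := (Classical.choose_spec exists_phi).2.1
lemma phi2 : phi k (gX k 2) = Lz (rX k) (rY k) (rZ k) := (Classical.choose_spec exists_phi).2.2

lemma phi_rho (r : SR k) : phi k (rho k r) = algebraMap (SR k) _ r := by
  refine rho_ext (phi k : Skly k →+* Module.End (SR k) (Fin 8 → SR k))
    (algebraMap (SR k) (Module.End (SR k) (Fin 8 → SR k))) ?_ ?_ ?_ ?_ r
  · intro c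
    rw [RingHom.coe_coe, AlgHom.commutes]; rfl
  · rw [RingHom.coe_coe, map_pow, phi0, pow_two, Lx_sq]
  · rw [RingHom.coe_coe, map_pow, phi1, pow_two, Ly_sq]
  · rw [RingHom.coe_coe, map_pow, phi2, pow_two, Lz_sq]

lemma phi_smul (r : SR k) (a : Skly k) : phi k (r • a) = r • phi k a := by
  rw [rsmul_def, map_mul, phi_rho, Algebra.smul_def]

lemma mulx (v : Fin 8 → SR k) : gX k 0 * Phi v = Phi (Lx (rX k) v) := by
  obtain ⟨-, -, sx, sy, sz, -, -⟩ := rho_spec k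
  have X1 : ∀ a, gX k 0 * (gX k 0 * a) = rX k • a := by
    intro a; rw [rsmul_def, sx]; noncomm_ring
  have X0 : gX k 0 * gX k 0 = rX k • 1 := by rw [← X1, mul_one]
  simp only [Phi, mul_add, mul_smul_comm, X0, X1, Lx_apply, mul_one]
  simp
  module

lemma muly (v : Fin 8 → SR k) : gX k 1 * Phi v = Phi (Ly (rY k) (rZ k) v) := by
  obtain ⟨-, -, sx, sy, sz, -, -⟩ := rho_spec k
  have Y1 : ∀ a, gX k 1 * (gX k 1 * a) = rY k • a := by
    intro a; rw [rsmul_def, sy]; noncomm_ring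
  have Y0 : gX k 1 * gX k 1 = rY k • 1 := by rw [← Y1, mul_one]
  have YX : ∀ a, gX k 1 * (gX k 0 * a) = rZ k • a - gX k 0 * (gX k 1 * a) := by
    intro a; rw [rsmul_def, sz, ← rel1]; noncomm_ring
  have YX0 : gX k 1 * gX k 0 = rZ k • 1 - gX k 0 * gX k 1 := by
    have := YX 1; simpa only [mul_one] using this
  simp only [Phi, mul_add, mul_smul_comm, Y0, Y1, YX, YX0, Ly_apply, mul_one]
  simp
  module

lemma mulz (v : Fin 8 → SR k) : gX k 2 * Phi v = Phi (Lz (rX k) (rY k) (rZ k) v) := by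
  obtain ⟨-, -, sx, sy, sz, -, -⟩ := rho_spec k
  have Z1 : ∀ a, gX k 2 * (gX k 2 * a) = rZ k • a := by
    intro a; rw [rsmul_def, sz]; noncomm_ring
  have Z0 : gX k 2 * gX k 2 = rZ k • 1 := by rw [← Z1, mul_one]
  have ZX : ∀ a, gX k 2 * (gX k 0 * a) = rY k • a - gX k 0 * (gX k 2 * a) := by
    intro a; rw [rsmul_def, sy, ← rel3]; noncomm_ring
  have ZX0 : gX k 2 * gX k 0 = rY k • 1 - gX k 0 * gX k 2 := by
    have := ZX 1; simpa only [mul_one] using this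
  have ZY : ∀ a, gX k 2 * (gX k 1 * a) = rX k • a - gX k 1 * (gX k 2 * a) := by
    intro a; rw [rsmul_def, sx, ← rel2]; noncomm_ring
  have ZY0 : gX k 2 * gX k 1 = rX k • 1 - gX k 1 * gX k 2 := by
    have := ZY 1; simpa only [mul_one] using this
  simp only [Phi, mul_add, mul_sub, mul_smul_comm, Z0, Z1, ZX, ZX0, ZY, ZY0, Lz_apply, mul_one]
  simp
  module

lemma Phi_add (u v : Fin 8 → SR k) : Phi (u + v) = Phi u + Phi v := by
  simp only [Phi, Pi.add_apply]; module
lemma Phi_smul (c : SR k) (v : Fin 8 → SR k) : Phi (c • v) = c • Phi v := by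
  simp only [Phi, Pi.smul_apply, smul_eq_mul]; module

lemma Phi_phi (a : Skly k) (v : Fin 8 → SR k) : Phi (phi k a v) = a * Phi v := by
  induction a using skly_induction generalizing v with
  | h0 c =>
    rw [← (rho_spec k).2.1, phi_rho, Module.algebraMap_end_apply, Phi_smul, rsmul_def]
  | h1 i =>
    fin_cases i
    · exact (congrArg (fun f : Module.End (SR k) (Fin 8 → SR k) => Phi (f v)) phi0).trans (mulx v).symm
    · exact (congrArg (fun f : Module.End (SR k) (Fin 8 → SR k) => Phi (f v)) phi1).trans (muly v).symm
    · exact (congrArg (fun f : Module.End (SR k) (Fin 8 → SR k) => Phi (f v)) phi2).trans (mulz v).symm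
  | hm a b ha hb => rw [map_mul, Module.End.mul_apply, ha, hb, mul_assoc]
  | ha a b ha hb => rw [map_add, LinearMap.add_apply, Phi_add, ha, hb, add_mul]

def e0 : Fin 8 → SR k := ![1, 0, 0, 0, 0, 0, 0, 0]
lemma Phi_e0 : Phi (e0 : Fin 8 → SR k) = 1 := by simp [Phi, e0]

/-- coordinates -/
def co (a : Skly k) : Fin 8 → SR k := phi k a e0
lemma Phi_co (a : Skly k) : Phi (co a) = a := by rw [co, Phi_phi, Phi_e0, mul_one]
lemma co_Phi (v : Fin 8 → SR k) : co (Phi v) = v := by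
  simp only [co, Phi, map_add, phi_smul, map_mul, phi0, phi1, phi2, map_one]
  ext i
  fin_cases i <;> simp [e0, Lx_apply, Ly_apply, Lz_apply]
lemma phi_inj {a b : Skly k} (h : phi k a = phi k b) : a = b := by
  rw [← Phi_co a, ← Phi_co b, co, co, h]
lemma Phi_inj {u v : Fin 8 → SR k} (h : Phi u = Phi v) : u = v := by
  rw [← co_Phi u, ← co_Phi v, h]

end Alg

section Model2
variable {R : Type*} [CommRing R] (x y z : R)

lemma Lg_x : Lx x * (Lx x * (Ly y z * Lz x y z) - Lz x y z * (Ly y z * Lx x)) =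
    (Lx x * (Ly y z * Lz x y z) - Lz x y z * (Ly y z * Lx x)) * Lx x := by
  refine LinearMap.ext fun v => ?_
  ext i; fin_cases i <;> simp [Lx_apply, Ly_apply, Lz_apply] <;> ring

lemma Lg_y : Ly y z * (Lx x * (Ly y z * Lz x y z) - Lz x y z * (Ly y z * Lx x)) =
    (Lx x * (Ly y z * Lz x y z) - Lz x y z * (Ly y z * Lx x)) * Ly y z := by
  refine LinearMap.ext fun v => ?_
  ext i; fin_cases i <;> simp [Lx_apply, Ly_apply, Lz_apply] <;> ring

lemma Lg_z : Lz x y z * (Lx x * (Ly y z * Lz x y z) - Lz x y z * (Ly y z * Lx x)) =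
    (Lx x * (Ly y z * Lz x y z) - Lz x y z * (Ly y z * Lx x)) * Lz x y z := by
  refine LinearMap.ext fun v => ?_
  ext i; fin_cases i <;> simp [Lx_apply, Ly_apply, Lz_apply] <;> ring

end Model2

section Fin
variable {k : Type*} [Field k] [CharZero k]

lemma exists_eps : ∃ f : Skly k →ₐ[k] Skly k, f (gX k 0) = -gX k 0 ∧ f (gX k 1) = -gX k 1 ∧
    f (gX k 2) = -gX k 2 := by
  apply skly_lift
  · simpa using rel1 k
  · simpa using rel2 k
  · simpa using rel3 k

variable (k) in
/-- The parity automorphism. -/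
def eps : Skly k →ₐ[k] Skly k := Classical.choose exists_eps
lemma eps0 : eps k (gX k 0) = -gX k 0 := (Classical.choose_spec exists_eps).1
lemma eps1 : eps k (gX k 1) = -gX k 1 := (Classical.choose_spec exists_eps).2.1
lemma eps2 : eps k (gX k 2) = -gX k 2 := (Classical.choose_spec exists_eps).2.2

lemma eps_rho (r : SR k) : eps k (rho k r) = rho k r := by
  obtain ⟨-, s1, sx, sy, sz, -, -⟩ := rho_spec k
  refine rho_ext (eps k : Skly k →+* Skly k) (rho k) ?_ ?_ ?_ ?_ r
  · intro c
    rw [RingHom.coe_coe, AlgHom.commutes, s1]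
  · rw [RingHom.coe_coe, map_pow, eps0, neg_sq, sx]
  · rw [RingHom.coe_coe, map_pow, eps1, neg_sq, sy]
  · rw [RingHom.coe_coe, map_pow, eps2, neg_sq, sz]

lemma eps_smul (r : SR k) (a : Skly k) : eps k (r • a) = r • eps k a := by
  rw [rsmul_def, map_mul, eps_rho, rsmul_def]

lemma eps_Phi (v : Fin 8 → SR k) :
    eps k (Phi v) = Phi ![v 0, -v 1, -v 2, -v 3, v 4, v 5, v 6, -v 7] := by
  simp only [Phi, map_add, eps_smul, map_mul, eps0, eps1, eps2, map_one]
  simp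

lemma neg_Phi (v : Fin 8 → SR k) : -Phi v = Phi (-v) := by
  rw [← neg_one_smul (SR k) v, Phi_smul, neg_one_smul]

lemma zero_of_eq_neg {a : SR k} (h : a = -a) : a = 0 := self_eq_neg.mp h

variable [IsAlgClosed k]

lemma sq_zero_even (T : Skly k) (hT : eps k T = T) (h : T * T = 0) : T = 0 := by
  obtain ⟨v, rfl⟩ : ∃ v, Phi v = T := ⟨_, Phi_co T⟩
  rw [eps_Phi] at hT
  have hv := Phi_inj hT
  have v1 : v 1 = 0 := zero_of_eq_neg (congrFun hv 1).symm
  have v2 : v 2 = 0 := zero_of_eq_neg (congrFun hv 2).symm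
  have v3 : v 3 = 0 := zero_of_eq_neg (congrFun hv 3).symm
  have v7 : v 7 = 0 := zero_of_eq_neg (congrFun hv 7).symm
  have hv' : v = ![v 0, 0, 0, 0, v 4, v 5, v 6, 0] := by
    ext i; fin_cases i <;> simp [v1, v2, v3, v7]
  have h2 : phi k (Phi v) v = 0 := by
    apply Phi_inj
    rw [Phi_phi, h]; simp [Phi]
  have hp : phi k (Phi v) = v 0 • (1 : Module.End (SR k) (Fin 8 → SR k))
      + v 4 • (Lx (rX k) * Ly (rY k) (rZ k)) + v 5 • (Lx (rX k) * Lz (rX k) (rY k) (rZ k))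
      + v 6 • (Ly (rY k) (rZ k) * Lz (rX k) (rY k) (rZ k)) := by
    simp only [Phi, map_add, phi_smul, map_mul, phi0, phi1, phi2, map_one, v1, v2, v3, v7,
      zero_smul, add_zero]
  rw [hp] at h2
  have h3 : v 4 = 0 ∧ v 5 = 0 ∧ v 6 = 0 ∧ v 0 = 0 := by
    apply even_sq (rX k) (rY k) (rZ k) (q_aniso k) (disc_ne k)
    rw [← hv']; exact h2
  obtain ⟨e1, e2, e3, e4⟩ := h3
  simp [Phi, v1, v2, v3, v7, e1, e2, e3, e4]

lemma sq_zero_odd (T : Skly k) (hT : eps k T = -T) (h : T * T = 0) : T = 0 := by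
  obtain ⟨v, rfl⟩ : ∃ v, Phi v = T := ⟨_, Phi_co T⟩
  rw [eps_Phi, neg_Phi] at hT
  have hv := Phi_inj hT
  have v1 : v 0 = 0 := zero_of_eq_neg (congrFun hv 0)
  have v2 : v 4 = 0 := zero_of_eq_neg (congrFun hv 4)
  have v3 : v 5 = 0 := zero_of_eq_neg (congrFun hv 5)
  have v7 : v 6 = 0 := zero_of_eq_neg (congrFun hv 6)
  have hv' : v = ![0, v 1, v 2, v 3, 0, 0, 0, v 7] := by
    ext i; fin_cases i <;> simp [v1, v2, v3, v7]
  have h2 : phi k (Phi v) v = 0 := by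
    apply Phi_inj
    rw [Phi_phi, h]; simp [Phi]
  have hp : phi k (Phi v) = v 1 • Lx (rX k)
      + v 2 • Ly (rY k) (rZ k) + v 3 • Lz (rX k) (rY k) (rZ k)
      + v 7 • (Lx (rX k) * (Ly (rY k) (rZ k) * Lz (rX k) (rY k) (rZ k))) := by
    simp only [Phi, map_add, phi_smul, map_mul, phi0, phi1, phi2, map_one, v1, v2, v3, v7,
      zero_smul, add_zero, zero_add]
  rw [hp] at h2
  have h3 : v 1 = 0 ∧ v 2 = 0 ∧ v 3 = 0 ∧ v 7 = 0 := by
    apply odd_sq (rX k) (rY k) (rZ k) (q_aniso k) (disc_ne k)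
    rw [← hv']; exact h2
  obtain ⟨e1, e2, e3, e4⟩ := h3
  simp [Phi, v1, v2, v3, v7, e1, e2, e3, e4]

lemma sq_zero_hom (n : ℕ) (T : Skly k) (hT : eps k T = (-1) ^ n * T) (h : T * T = 0) : T = 0 := by
  rcases Nat.even_or_odd n with hn | hn
  · rw [hn.neg_one_pow, one_mul] at hT; exact sq_zero_even T hT h
  · rw [hn.neg_one_pow, neg_one_mul] at hT; exact sq_zero_odd T hT h


lemma exists_del : ∃ f : Skly k →ₐ[k] (Skly k)[X], f (gX k 0) = C (gX k 0) * X ∧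
    f (gX k 1) = C (gX k 1) * X ∧ f (gX k 2) = C (gX k 2) * X := by
  have key : ∀ a b : Skly k, (C a * X) * (C b * X) = C (a * b) * X ^ 2 := by
    intro a b
    rw [C_mul, mul_assoc, ← mul_assoc X (C b) X, X_mul_C, pow_two, mul_assoc, mul_assoc]
  apply skly_lift
  · rw [key, key, ← add_mul, ← C_add, rel1, pow_two (C (gX k 2) * X), key, pow_two (gX k 2)]
  · rw [key, key, ← add_mul, ← C_add, rel2, pow_two (C (gX k 0) * X), key, pow_two (gX k 0)]
  · rw [key, key, ← add_mul, ← C_add, rel3, pow_two (C (gX k 1) * X), key, pow_two (gX k 1)]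

variable (k) in
/-- The grading coaction. -/
def del : Skly k →ₐ[k] (Skly k)[X] := Classical.choose exists_del
lemma del0 : del k (gX k 0) = C (gX k 0) * X := (Classical.choose_spec exists_del).1
lemma del1 : del k (gX k 1) = C (gX k 1) * X := (Classical.choose_spec exists_del).2.1
lemma del2 : del k (gX k 2) = C (gX k 2) * X := (Classical.choose_spec exists_del).2.2
lemma del_g (i : Fin 3) : del k (gX k i) = C (gX k i) * X := by
  fin_cases i
  · exact del0
  · exact del1
  · exact del2
lemma eps_g (i : Fin 3) : eps k (gX k i) = -gX k i := by
  fin_cases i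
  · exact eps0
  · exact eps1
  · exact eps2

lemma eps_coeff (a : Skly k) (n : ℕ) : eps k ((del k a).coeff n) = (-1) ^ n * (del k a).coeff n := by
  induction a using skly_induction generalizing n with
  | h0 c =>
    rw [AlgHom.commutes, Polynomial.algebraMap_apply, coeff_C]
    split_ifs with h
    · rw [h, AlgHom.commutes, pow_zero, one_mul]
    · rw [map_zero, mul_zero]
  | h1 i =>
    rw [del_g, coeff_C_mul, coeff_X]
    split_ifs with h
    · rw [← h, mul_one, eps_g, pow_one, neg_one_mul]
    · rw [mul_zero, map_zero, mul_zero]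
  | hm a b ha hb =>
    rw [map_mul, coeff_mul, map_sum, Finset.mul_sum]
    refine Finset.sum_congr rfl fun p hp => ?_
    rw [map_mul, ha, hb, ← Finset.HasAntidiagonal.mem_antidiagonal.mp hp, pow_add]
    rcases neg_one_pow_eq_or (Skly k) p.2 with h | h <;> rw [h] <;> noncomm_ring
  | ha a b ha hb => rw [map_add, coeff_add, map_add, ha, hb, mul_add]

/-- A linear form. -/
def lin (a b c : k) : Skly k := a • gX k 0 + b • gX k 1 + c • gX k 2

lemma low_coeff (a : Skly k) : (∃ d : k, (del k a).coeff 0 = algebraMap k _ d) ∧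
    ∃ p q r : k, (del k a).coeff 1 = lin p q r := by
  induction a using skly_induction with
  | h0 c =>
    rw [AlgHom.commutes, Polynomial.algebraMap_apply, coeff_C, coeff_C]
    exact ⟨⟨c, rfl⟩, 0, 0, 0, by simp [lin]⟩
  | h1 i =>
    rw [del_g]
    refine ⟨⟨0, by simp⟩, ?_⟩
    rw [coeff_C_mul, coeff_X_one, mul_one]
    fin_cases i
    · exact ⟨1, 0, 0, by simp [lin]⟩
    · exact ⟨0, 1, 0, by simp [lin]⟩
    · exact ⟨0, 0, 1, by simp [lin]⟩
  | hm a b ha hb =>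
    obtain ⟨⟨d, hd⟩, p, q, r, h⟩ := ha
    obtain ⟨⟨d', hd'⟩, p', q', r', h'⟩ := hb
    rw [map_mul, mul_coeff_zero, mul_coeff_one, hd, hd', h, h']
    refine ⟨⟨d * d', (map_mul _ _ _).symm⟩, d * p' + d' * p, d * q' + d' * q, d * r' + d' * r, ?_⟩
    rw [← Algebra.commutes d' (lin p q r), ← Algebra.smul_def, ← Algebra.smul_def]
    simp only [lin]
    module
  | ha a b ha hb =>
    obtain ⟨⟨d, hd⟩, p, q, r, h⟩ := ha
    obtain ⟨⟨d', hd'⟩, p', q', r', h'⟩ := hb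
    rw [map_add, coeff_add, coeff_add, hd, hd', h, h']
    refine ⟨⟨d + d', (map_add _ _ _).symm⟩, p + p', q + q', r + r', ?_⟩
    simp only [lin]
    module

variable (k) in
/-- Evaluation at `1`. -/
def ev : (Skly k)[X] →+* Skly k :=
  eval₂RingHom' (RingHom.id (Skly k)) 1 fun _ => Commute.one_right _

lemma ev_CX (a : Skly k) : ev k (C a * X) = a := by
  simp [ev]
lemma ev_del (a : Skly k) : ev k (del k a) = a := by
  induction a using skly_induction with
  | h0 c =>
    rw [AlgHom.commutes, Polynomial.algebraMap_apply]
    simp [ev]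
  | h1 i => rw [del_g, ev_CX]
  | hm a b ha hb => rw [map_mul, map_mul, ha, hb]
  | ha a b ha hb => rw [map_add, map_add, ha, hb]

lemma linear_of_sq (a : Skly k) (i : Fin 3) (h : a * a = gX k i ^ 2) :
    ∃ p q r : k, a = lin p q r := by
  have hP : del k a * del k a = C (gX k i ^ 2) * X ^ 2 := by
    rw [← map_mul, h, map_pow, del_g, pow_two, pow_two, C_mul, mul_assoc,
      ← mul_assoc X (C _) X, X_mul_C, pow_two, mul_assoc, mul_assoc]
  have hN : (del k a).natDegree ≤ 1 := by
    by_contra hN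
    have h1 := coeff_mul_degree_add_degree (del k a) (del k a)
    rw [hP, coeff_C_mul, coeff_X_pow, if_neg (by omega), mul_zero] at h1
    have h2 := sq_zero_hom _ _ (eps_coeff a (del k a).natDegree) h1.symm
    have h3 : del k a = 0 := leadingCoeff_eq_zero.mp h2
    rw [h3] at hN
    simp at hN
  have h0 : (del k a).coeff 0 = 0 := by
    apply sq_zero_hom 0 _ (eps_coeff a 0)
    rw [← mul_coeff_zero, hP, coeff_C_mul, coeff_X_pow, if_neg (by omega), mul_zero]
  have h1 := eq_X_add_C_of_natDegree_le_one hN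
  rw [h0, C_0, add_zero] at h1
  obtain ⟨-, p, q, r, h2⟩ := low_coeff a
  refine ⟨p, q, r, ?_⟩
  rw [← h2, ← ev_CX ((del k a).coeff 1), ← h1, ev_del]

lemma rho_inj {r s : SR k} (h : rho k r = rho k s) : r = s := by
  have := Phi_inj (u := ![r, 0, 0, 0, 0, 0, 0, 0]) (v := ![s, 0, 0, 0, 0, 0, 0, 0])
    (by simp [Phi, rsmul_def, h])
  exact congrFun this 0

lemma lin_mul (a b c a' b' c' : k) : lin a b c * lin a' b' c' + lin a' b' c' * lin a b c =
    rho k (rC k (2 * (a * a') + b * c' + c * b') * rX k + rC k (2 * (b * b') + c * a' + a * c') * rY k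
      + rC k (2 * (c * c') + a * b' + b * a') * rZ k) := by
  obtain ⟨-, s1, sx, sy, sz, -, -⟩ := rho_spec k
  simp only [map_add, map_mul, s1, sx, sy, sz]
  simp only [← map_mul, ← map_add, ← map_ofNat (algebraMap k (Skly k)), ← Algebra.smul_def]
  have e : lin a b c * lin a' b' c' + lin a' b' c' * lin a b c =
     (2 * (a * a')) • gX k 0 ^ 2 + (2 * (b * b')) • gX k 1 ^ 2 + (2 * (c * c')) • gX k 2 ^ 2 +
     (a * b' + b * a') • (gX k 0 * gX k 1 + gX k 1 * gX k 0)
     + (b * c' + c * b') • (gX k 1 * gX k 2 + gX k 2 * gX k 1)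
     + (c * a' + a * c') • (gX k 2 * gX k 0 + gX k 0 * gX k 2) := by
    simp only [lin, mul_add, add_mul, smul_mul_smul_comm, pow_two]
    module
  rw [e, rel1, rel2, rel3]
  module

lemma lin_eqs {a b c a' b' c' p q r : k}
    (h : lin a b c * lin a' b' c' + lin a' b' c' * lin a b c =
      p • gX k 0 ^ 2 + q • gX k 1 ^ 2 + r • gX k 2 ^ 2) :
    2 * (a * a') + b * c' + c * b' = p ∧ 2 * (b * b') + c * a' + a * c' = q ∧
    2 * (c * c') + a * b' + b * a' = r := by
  obtain ⟨-, s1, sx, sy, sz, -, -⟩ := rho_spec k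
  rw [lin_mul] at h
  have h2 : p • gX k 0 ^ 2 + q • gX k 1 ^ 2 + r • gX k 2 ^ 2 =
      rho k (rC k p * rX k + rC k q * rY k + rC k r * rZ k) := by
    simp only [map_add, map_mul, s1, sx, sy, sz, Algebra.smul_def]
  rw [h2] at h
  have h3 := rho_inj h
  have := rXYZ_indep k (2 * (a * a') + b * c' + c * b' - p) (2 * (b * b') + c * a' + a * c' - q)
    (2 * (c * c') + a * b' + b * a' - r) (by
      rw [map_sub, map_sub, map_sub]; linear_combination h3)
  obtain ⟨e1, e2, e3⟩ := this
  exact ⟨sub_eq_zero.mp e1, sub_eq_zero.mp e2, sub_eq_zero.mp e3⟩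

lemma row_cases {a b c : k} (h1 : a ^ 2 + b * c = 1) (h2 : b ^ 2 + c * a = 0)
    (h3 : c ^ 2 + a * b = 0) : (b = 0 ∧ c = 0) ∨ (b * c = a ^ 2 ∧ a ≠ 0) := by
  have h : (b * c) * (b * c - a ^ 2) = 0 := by linear_combination c ^ 2 * h2 - c * a * h3
  rcases mul_eq_zero.mp h with h | h
  · left
    rcases mul_eq_zero.mp h with h | h
    · subst h
      refine ⟨rfl, ?_⟩
      simpa using h3
    · subst h
      refine ⟨?_, rfl⟩
      simpa using h2
  · right
    refine ⟨sub_eq_zero.mp h, ?_⟩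
    rintro rfl
    have : (1 : k) = 0 := by linear_combination h - h1
    exact one_ne_zero this

lemma pair_rows {a b c a' b' c' : k} (h1 : a ^ 2 + b * c = 1) (h2 : b ^ 2 + c * a = 0)
    (h3 : c ^ 2 + a * b = 0) (h1' : b' ^ 2 + c' * a' = 1) (h2' : c' ^ 2 + a' * b' = 0)
    (h3' : a' ^ 2 + b' * c' = 0) (k1 : 2 * (a * a') + b * c' + c * b' = 0)
    (k2 : 2 * (b * b') + c * a' + a * c' = 0) (k3 : 2 * (c * c') + a * b' + b * a' = 1) :
    b = 0 ∧ c = 0 ∧ a' = 0 ∧ c' = 0 ∧ a * b' = 1 := by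
  rcases row_cases h1 h2 h3 with ⟨rfl, rfl⟩ | ⟨e, ha⟩ <;>
  rcases row_cases h1' h2' h3' with ⟨rfl, rfl⟩ | ⟨e', hb⟩
  · refine ⟨rfl, rfl, rfl, rfl, ?_⟩
    linear_combination k3
  · exfalso
    have ha : a ≠ 0 := by rintro rfl; simp at h1
    have : c' = 0 := by simpa [ha] using k2
    subst this
    simp at e'
    exact hb (pow_eq_zero_iff two_ne_zero |>.mp e'.symm)
  · exfalso
    have : c = 0 := by
      have hb : b' ≠ 0 := by rintro rfl; simp at h1'
      simpa [hb] using k1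
    subst this
    simp at e
    exact ha (pow_eq_zero_iff two_ne_zero |>.mp e.symm)
  · exfalso
    -- `b = u a`, `c = u⁻¹ a`, and similarly for the other row
    obtain ⟨u, rfl⟩ : ∃ u, b = u * a := ⟨b / a, by field_simp⟩
    obtain ⟨v, rfl⟩ : ∃ v, c = v * a := ⟨c / a, by field_simp⟩
    obtain ⟨s, rfl⟩ : ∃ s, c' = s * b' := ⟨c' / b', by field_simp⟩
    obtain ⟨t, rfl⟩ : ∃ t, a' = t * b' := ⟨a' / b', by field_simp⟩
    have a2 : a ^ 2 ≠ 0 := pow_ne_zero _ ha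
    have b2 : b' ^ 2 ≠ 0 := pow_ne_zero _ hb
    have ab : a * b' ≠ 0 := mul_ne_zero ha hb
    have uv : v = - u ^ 2 := by
      apply mul_left_cancel₀ a2; linear_combination h2
    have us : u = - v ^ 2 := by
      apply mul_left_cancel₀ a2; linear_combination h3
    have uu : u * v = 1 := by
      apply mul_left_cancel₀ a2; linear_combination e
    have st : t = - s ^ 2 := by
      apply mul_left_cancel₀ b2; linear_combination h2'
    have ss : s * t = 1 := by
      apply mul_left_cancel₀ b2; linear_combination e'
    have kk : 2 * t + u * s + v = 0 := by
      apply mul_left_cancel₀ ab; linear_combination k1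
    subst uv st
    -- `w = u * t` satisfies `w ^ 2 - w + 2 = 0` up to sign and `w ^ 3 = 1`
    grind

/-- The central cubic element. -/
def gc (k : Type*) [Field k] : Skly k := gX k 0 * (gX k 1 * gX k 2) - gX k 2 * (gX k 1 * gX k 0)

lemma gc_center : gc k ∈ Subalgebra.center k (Skly k) := by
  apply mem_center_of
  intro i
  apply phi_inj
  fin_cases i
  · simp only [gc, map_mul, map_sub, phi0, phi1, phi2, Fin.zero_eta]
    exact Lg_x _ _ _
  · simp only [gc, map_mul, map_sub, phi0, phi1, phi2, Fin.mk_one]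
    exact Lg_y _ _ _
  · simp only [gc, map_mul, map_sub, phi0, phi1, phi2, Fin.reduceFinMk]
    exact Lg_z _ _ _

lemma gc_ne : gc k ≠ 0 := by
  intro h
  have h1 : phi k (gc k) = 0 := by rw [h, map_zero]
  have h2 := congrFun (LinearMap.congr_fun h1 e0) 7
  simp only [gc, map_mul, map_sub, phi0, phi1, phi2] at h2
  simp [Lx_apply, Ly_apply, Lz_apply, e0] at h2

lemma ozone_fix (σ : Skly k ≃ₐ[k] Skly k) (hσ : ∀ z ∈ Subalgebra.center k (Skly k), σ z = z)
    (i : Fin 3) : σ (gX k i) = gX k i := by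
  have hq : ∀ i, σ (gX k i) ^ 2 = gX k i ^ 2 := fun i => by
    rw [← map_pow]; exact hσ _ (sq_mem_center i)
  have hl : ∀ i, ∃ p q r : k, σ (gX k i) = lin p q r := fun i =>
    linear_of_sq _ i (by rw [← pow_two, hq])
  obtain ⟨a, b, c, hx⟩ := hl 0
  obtain ⟨a', b', c', hy⟩ := hl 1
  obtain ⟨a'', b'', c'', hz⟩ := hl 2
  have X2 := hq 0
  have Y2 := hq 1
  have Z2 := hq 2
  have XY := congrArg σ (rel1 k)
  have YZ := congrArg σ (rel2 k)
  rw [map_add, map_mul, map_mul, map_pow, hq, hx, hy] at XY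
  rw [map_add, map_mul, map_mul, map_pow, hq, hy, hz] at YZ
  rw [hx, pow_two] at X2
  rw [hy, pow_two] at Y2
  rw [hz, pow_two] at Z2
  have two : (2 : k) ≠ 0 := two_ne_zero
  obtain ⟨p1, p2, p3⟩ := lin_eqs (a := a) (b := b) (c := c) (a' := a) (b' := b) (c' := c)
    (p := 2) (q := 0) (r := 0) (by rw [X2]; module)
  obtain ⟨q1, q2, q3⟩ := lin_eqs (a := a') (b := b') (c := c') (a' := a') (b' := b') (c' := c')
    (p := 0) (q := 2) (r := 0) (by rw [Y2]; module)
  obtain ⟨r1, r2, r3⟩ := lin_eqs (a := a'') (b := b'') (c := c'') (a' := a'') (b' := b'')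
    (c' := c'') (p := 0) (q := 0) (r := 2) (by rw [Z2]; module)
  obtain ⟨s1, s2, s3⟩ := lin_eqs (a := a) (b := b) (c := c) (a' := a') (b' := b') (c' := c')
    (p := 0) (q := 0) (r := 1) (by rw [XY]; module)
  obtain ⟨t1, t2, t3⟩ := lin_eqs (a := a') (b := b') (c := c') (a' := a'') (b' := b'') (c' := c'')
    (p := 1) (q := 0) (r := 0) (by rw [YZ]; module)
  have m1 : a ^ 2 + b * c = 1 := by apply mul_left_cancel₀ two; linear_combination p1
  have m2 : b ^ 2 + c * a = 0 := by apply mul_left_cancel₀ two; linear_combination p2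
  have m3 : c ^ 2 + a * b = 0 := by apply mul_left_cancel₀ two; linear_combination p3
  have n1 : b' ^ 2 + c' * a' = 1 := by apply mul_left_cancel₀ two; linear_combination q2
  have n2 : c' ^ 2 + a' * b' = 0 := by apply mul_left_cancel₀ two; linear_combination q3
  have n3 : a' ^ 2 + b' * c' = 0 := by apply mul_left_cancel₀ two; linear_combination q1
  have o1 : c'' ^ 2 + a'' * b'' = 1 := by apply mul_left_cancel₀ two; linear_combination r3
  have o2 : a'' ^ 2 + b'' * c'' = 0 := by apply mul_left_cancel₀ two; linear_combination r1
  have o3 : b'' ^ 2 + c'' * a'' = 0 := by apply mul_left_cancel₀ two; linear_combination r2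
  obtain ⟨rfl, rfl, rfl, rfl, e1⟩ := pair_rows m1 m2 m3 n1 n2 n3 s1 s2 s3
  obtain ⟨-, -, rfl, rfl, e2⟩ := pair_rows n1 n2 n3 o1 o2 o3 t2 t3 t1
  have hb : b' = a := by linear_combination a * e1 - b' * m1
  have hc : c'' = b' := by linear_combination b' * e2 - c'' * n1
  subst hc
  subst hb
  have ha : (c'' - 1) * (c'' + 1) = 0 := by linear_combination e1
  rcases mul_eq_zero.mp ha with h | h
  · have h := sub_eq_zero.mp h
    subst h
    fin_cases i
    · exact hx.trans (by simp [lin])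
    · exact hy.trans (by simp [lin])
    · exact hz.trans (by simp [lin])
  · exfalso
    have h := eq_neg_of_add_eq_zero_left h
    subst h
    have hx' : σ (gX k 0) = -gX k 0 := hx.trans (by simp [lin])
    have hy' : σ (gX k 1) = -gX k 1 := hy.trans (by simp [lin])
    have hz' : σ (gX k 2) = -gX k 2 := hz.trans (by simp [lin])
    have h1 := hσ _ gc_center
    have h2 : σ (gc k) = -gc k := by
      rw [gc, map_sub, map_mul, map_mul, map_mul, map_mul, hx', hy', hz']
      noncomm_ring
    rw [h2] at h1
    apply gc_ne (k := k)
    apply skly_two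
    nth_rewrite 1 [← h1]
    exact neg_add_cancel _

end Fin

end Aux

/-- Suppose `k` is algebraically closed of characteristic 0. Then the
ozone group of the three-dimensional Sklyanin algebra `S(1,1,−1)` is trivial: the only
`k`-algebra automorphism fixing the center pointwise is the identity. -/
theorem stmt7 (k : Type*) [Field k] [CharZero k] [IsAlgClosed k] :
    ozoneGroup k (Skly k) = ⊥ := by
  rw [Subgroup.eq_bot_iff_forall]
  intro σ hσ
  refine AlgEquiv.ext fun a => ?_
  have hσ' : ∀ z ∈ Subalgebra.center k (Skly k), σ z = z := hσ
  change σ a = a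
  induction a using skly_induction with
  | h0 c => exact σ.commutes c
  | h1 i => exact ozone_fix σ hσ' i
  | hm a b ha hb => rw [map_mul, ha, hb]
  | ha a b ha hb => rw [map_add, ha, hb]
end
end
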